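/- arXiv:1603.08838 — 4 statements merged into one kernel-verified Lean document; each statement's English description precedes it below -/
import Mathlib

section
/- Let x be a minimal (p,q)-configuration with action A_{p,q}, and for N ≥ 2 let A_N be as in the setting. Let β : ℝ → ℝ be a convex function satisfying q·β(p/q) = A_{p,q} and (Nq−1)·β(Np/(Nq−1)) = A_N for all N ≥ 2. Suppose there exist λ ∈ (0,1), B ∈ ℝ, real constants C ≠ 0 and C' ≠ 0, K ≥ 0 and N₀ ∈ ℕ such that |A_N − N·A_{p,q} − B − C·λ^N| ≤ K·λ^{9N/8} for all even N ≥ N₀ and |A_N − N·A_{p,q} − B − C'·λ^N| ≤ K·λ^{9N/8} for all odd N ≥ N₀. Then B = (p/q)·β'₊(p/q) − β(p/q), where β'₊(p/q) denotes the right derivative of β at p/q (which exists by convexity), and lim_{N→+∞} (1/N)·log | (Nq−1)·β(Np/(Nq−1)) − Nq·β(p/q) − B | = log λ. (This is Theorem 5.4 / part (2) of the Main Theorem in its conditional twist-map form, with λ the eigenvalue in (0,1) of the linearized return map at the Aubry-Mather periodic orbit.) -/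
noncomputable section

open Filter

/-- Partial derivative of `h` with respect to its first argument. -/
def d1h (h : ℝ → ℝ → ℝ) (a b : ℝ) : ℝ := deriv (fun t => h t b) a

/-- Partial derivative of `h` with respect to its second argument. -/
def d2h (h : ℝ → ℝ → ℝ) (a b : ℝ) : ℝ := deriv (fun t => h a t) b

/-- The twist-map setting: `h` is a `C²` generating function, periodic in the
diagonal direction, satisfying the twist condition `∂₁∂₂ h < 0`. -/
def TwistSetting (h : ℝ → ℝ → ℝ) : Prop :=
  ContDiff ℝ 2 (fun u : ℝ × ℝ => h u.1 u.2) ∧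
  (∀ a b : ℝ, h (a + 1) (b + 1) = h a b) ∧
  (∀ a b : ℝ, deriv (fun t => d2h h t b) a < 0)

/-- A `(p,q)`-configuration: `x (i+q) = x i + p` for all `i`. -/
def IsConfigPQ (p q : ℕ) (x : ℤ → ℝ) : Prop :=
  ∀ i : ℤ, x (i + (q : ℤ)) = x i + (p : ℝ)

/-- The action of a `(p,q)`-configuration: `∑_{i=0}^{q-1} h(x_i, x_{i+1})`. -/
def cAction (h : ℝ → ℝ → ℝ) (q : ℕ) (x : ℤ → ℝ) : ℝ :=
  ∑ i ∈ Finset.Ico (0 : ℤ) (q : ℤ), h (x i) (x (i + 1))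

/-- A configuration is minimal if every finite segment minimizes the action
with fixed endpoints. -/
def IsMinimalConfig (h : ℝ → ℝ → ℝ) (x : ℤ → ℝ) : Prop :=
  ∀ m n : ℤ, m < n → ∀ w : ℤ → ℝ, w m = x m → w n = x n →
    (∑ i ∈ Finset.Ico m n, h (x i) (x (i + 1))) ≤
      ∑ i ∈ Finset.Ico m n, h (w i) (w (i + 1))

/-- `z` has `p/q+` asymptotics relative to the `(p,q)`-configuration `x`:
for each `i = 0, …, q-1`, `z_{Nq+i} - x_{i+1} → 0` and `z_{-Nq+i} - x_i → 0`
as `N → +∞`. -/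
def HasPQPlusAsymptotics (q : ℕ) (x z : ℤ → ℝ) : Prop :=
  ∀ i : ℤ, 0 ≤ i → i < (q : ℤ) →
    Filter.Tendsto (fun N : ℕ => z ((N : ℤ) * q + i) - x (i + 1))
      Filter.atTop (nhds 0) ∧
    Filter.Tendsto (fun N : ℕ => z (-((N : ℤ) * q) + i) - x i)
      Filter.atTop (nhds 0)

/-- The Peierls barrier value of `z` (relative to a `(p,q)`-configuration of
action `Apq`) is `B` if the double limit
`lim_{M,K→∞} [∑_{i=-Kq+1}^{Mq-1} h(z_i,z_{i+1}) - (M+K)·Apq] = B`. -/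
def HasBarrierValue (h : ℝ → ℝ → ℝ) (q : ℕ) (Apq : ℝ) (z : ℤ → ℝ) (B : ℝ) : Prop :=
  Filter.Tendsto
    (fun MK : ℕ × ℕ =>
      (∑ i ∈ Finset.Icc (-((MK.2 : ℤ) * q) + 1) ((MK.1 : ℤ) * q - 1),
          h (z i) (z (i + 1))) - ((MK.1 : ℝ) + (MK.2 : ℝ)) * Apq)
    Filter.atTop (nhds B)

/-- A configuration with `w_{i + (Nq-1)} = w_i + Np` for all `i`. -/
def IsConfigNpNq (p q N : ℕ) (w : ℤ → ℝ) : Prop :=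
  ∀ i : ℤ, w (i + ((N : ℤ) * q - 1)) = w i + (N : ℝ) * p

/-- The action `∑_{i=0}^{Nq-2} h(w_i, w_{i+1})` of such a configuration. -/
def npAction (h : ℝ → ℝ → ℝ) (q N : ℕ) (w : ℤ → ℝ) : ℝ :=
  ∑ i ∈ Finset.Ico (0 : ℤ) ((N : ℤ) * q - 1), h (w i) (w (i + 1))

/-- `A_N`: the infimum of the actions of configurations with
`w_{i+(Nq-1)} = w_i + Np`. -/
def AN (h : ℝ → ℝ → ℝ) (p q N : ℕ) : ℝ :=
  sInf {a : ℝ | ∃ w : ℤ → ℝ, IsConfigNpNq p q N w ∧ a = npAction h q N w}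


/-- A real sequence trapped between two positive multiples of `a ^ n`, `0 < a`, has exponential
rate `log a`. -/
lemma tendsto_one_div_mul_log_abs_of_le_of_le {e : ℕ → ℝ} {a m M : ℝ} (ha : 0 < a) (hm : 0 < m)
    (hl : ∀ᶠ n in atTop, m * a ^ n ≤ |e n|) (hu : ∀ᶠ n in atTop, |e n| ≤ M * a ^ n) :
    Tendsto (fun n : ℕ => (1 / (n : ℝ)) * Real.log |e n|) atTop (nhds (Real.log a)) := by
  have key (c : ℝ) : Tendsto (fun n : ℕ => Real.log c / (n : ℝ) + Real.log a) atTop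
      (nhds (Real.log a)) := by
    simpa using (tendsto_const_div_atTop_nhds_zero_nat (Real.log c)).add_const (Real.log a)
  have heq (c : ℝ) (hc : 0 < c) (n : ℕ) (hn : 0 < n) :
      Real.log c / (n : ℝ) + Real.log a = (1 / (n : ℝ)) * Real.log (c * a ^ n) := by
    have hn' : (n : ℝ) ≠ 0 := by positivity
    rw [Real.log_mul hc.ne' (pow_pos ha n).ne', Real.log_pow]
    field_simp
  refine tendsto_of_tendsto_of_tendsto_of_le_of_le' (key m) (key M) ?_ ?_
  · filter_upwards [hl, eventually_gt_atTop 0] with n h1 hn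
    rw [heq m hm n hn]
    gcongr
  · filter_upwards [hl, hu, eventually_gt_atTop 0] with n h1 h2 hn
    have hpos : 0 < |e n| := (mul_pos hm (pow_pos ha n)).trans_le h1
    rw [heq M (pos_of_mul_pos_left (hpos.trans_le h2) (pow_pos ha n).le) n hn]
    gcongr

/-- For `β` convex and `s > 0`, the increments `t * β (s + s / t) - (t + 1) * β s` converge to the
value at `s` of `s * β'₊ s - β s` as `t → ∞`. -/
lemma ConvexOn.tendsto_mul_add_div_sub {β : ℝ → ℝ} (hβ : ConvexOn ℝ Set.univ β) {s : ℝ}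
    (hs : 0 < s) :
    Tendsto (fun t : ℝ => t * β (s + s / t) - (t + 1) * β s) atTop
      (nhds (s * derivWithin β (Set.Ioi s) s - β s)) := by
  have hd : HasDerivWithinAt β (derivWithin β (Set.Ioi s) s) (Set.Ioi s) s :=
    (hβ.differentiableWithinAt_Ioi_of_mem_interior (by simp)).hasDerivWithinAt
  rw [hasDerivWithinAt_iff_tendsto_slope' (by simp)] at hd
  have hu : Tendsto (fun t : ℝ => s + s / t) atTop (nhdsWithin s (Set.Ioi s)) := by
    refine tendsto_nhdsWithin_iff.2 ⟨?_, ?_⟩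
    · simpa using (tendsto_const_nhds (x := s)).add (tendsto_const_nhds.div_atTop tendsto_id)
    · filter_upwards [eventually_gt_atTop 0] with t ht
      have : 0 < s / t := by positivity
      simpa using this
  refine (((hd.comp hu).const_mul s).sub_const (β s)).congr' ?_
  filter_upwards [eventually_gt_atTop 0] with t ht
  simp only [Function.comp_apply, slope_def_field, add_sub_cancel_left]
  field_simp
  ring

/-- If `e n` is `c n * a ^ n` up to `O(a ^ (9 n / 8))`, where `|c n|` stays between two positive
constants, then `e n` is eventually trapped between positive multiples of `a ^ n`. -/
lemma eventually_mul_pow_le_abs_and_abs_le {e c : ℕ → ℝ} {a m M K : ℝ} (ha : 0 < a) (ha1 : a < 1)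
    (hm : 0 < m) (hc : ∀ n, m ≤ |c n|) (hcM : ∀ n, |c n| ≤ M)
    (h : ∀ᶠ n : ℕ in atTop, |e n - c n * a ^ n| ≤ K * a ^ ((9 * (n : ℝ)) / 8)) :
    ∀ᶠ n in atTop, m / 2 * a ^ n ≤ |e n| ∧ |e n| ≤ (M + m / 2) * a ^ n := by
  have hpow (n : ℕ) : a ^ ((9 * (n : ℝ)) / 8) = (a ^ (1 / 8 : ℝ)) ^ n * a ^ n := by
    rw [← Real.rpow_natCast (a ^ (1 / 8 : ℝ)) n, ← Real.rpow_mul ha.le, ← Real.rpow_natCast a n,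
      ← Real.rpow_add ha]
    congr 1
    ring
  have hK : Tendsto (fun n : ℕ => K * (a ^ (1 / 8 : ℝ)) ^ n) atTop (nhds 0) := by
    simpa using (tendsto_pow_atTop_nhds_zero_of_lt_one (Real.rpow_nonneg ha.le _)
      (Real.rpow_lt_one ha.le ha1 (by norm_num))).const_mul K
  filter_upwards [h, hK.eventually_le_const (half_pos hm)] with n hn hKn
  have hp := pow_pos ha n
  have herr : |e n - c n * a ^ n| ≤ m / 2 * a ^ n := by
    rw [hpow, ← mul_assoc] at hn
    exact hn.trans (by gcongr)
  have habs : |c n * a ^ n| = |c n| * a ^ n := by rw [abs_mul, abs_of_pos hp]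
  have h1 : m * a ^ n ≤ |c n| * a ^ n := by gcongr; exact hc n
  have h2 : |c n| * a ^ n ≤ M * a ^ n := by gcongr; exact hcM n
  have h3 := abs_sub_abs_le_abs_sub (c n * a ^ n) (e n)
  have h4 := abs_sub_abs_le_abs_sub (e n) (c n * a ^ n)
  rw [abs_sub_comm] at h3
  constructor <;> linarith

/-- Theorem 5.4 / part (2) of the Main Theorem, conditional twist-map
form: with `x` a minimal `(p,q)`-configuration, `β` convex relating to the minimal
actions as Mather's β-function does, and a two-parity exponential expansion
`A_N − N·A_{p,q} = B + C·λ^N + O(λ^{9N/8})` with nonzero constants, one gets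
`B = (p/q)·β'₊(p/q) − β(p/q)` and
`lim (1/N)·log |(Nq−1)β(Np/(Nq−1)) − Nq·β(p/q) − B| = log λ`. -/
theorem stmt_1 (h : ℝ → ℝ → ℝ) (hts : TwistSetting h)
    (p q : ℕ) (hp : 0 < p) (hq : 0 < q) (hcop : Nat.Coprime p q)
    (hhalf : (p : ℝ) / q ≤ 1 / 2)
    (x : ℤ → ℝ) (hxpq : IsConfigPQ p q x) (hxmin : IsMinimalConfig h x)
    (β : ℝ → ℝ) (hconv : ConvexOn ℝ Set.univ β)
    (hβpq : (q : ℝ) * β ((p : ℝ) / q) = cAction h q x)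
    (hβN : ∀ N : ℕ, 2 ≤ N →
      ((N : ℝ) * q - 1) * β ((N : ℝ) * p / ((N : ℝ) * q - 1)) = AN h p q N)
    (lam B C C' K : ℝ) (hlam0 : 0 < lam) (hlam1 : lam < 1)
    (hC : C ≠ 0) (hC' : C' ≠ 0) (hK : 0 ≤ K) (N₀ : ℕ)
    (heven : ∀ N : ℕ, N₀ ≤ N → Even N →
      |AN h p q N - (N : ℝ) * cAction h q x - B - C * lam ^ N| ≤
        K * lam ^ ((9 * (N : ℝ)) / 8))
    (hodd : ∀ N : ℕ, N₀ ≤ N → Odd N →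
      |AN h p q N - (N : ℝ) * cAction h q x - B - C' * lam ^ N| ≤
        K * lam ^ ((9 * (N : ℝ)) / 8)) :
    B = ((p : ℝ) / q) * derivWithin β (Set.Ioi ((p : ℝ) / q)) ((p : ℝ) / q)
        - β ((p : ℝ) / q) ∧
    Filter.Tendsto
      (fun N : ℕ => (1 / (N : ℝ)) *
        Real.log |((N : ℝ) * q - 1) * β ((N : ℝ) * p / ((N : ℝ) * q - 1))
          - (N : ℝ) * q * β ((p : ℝ) / q) - B|)
      Filter.atTop (nhds (Real.log lam)) := by
  have hq0 : (0 : ℝ) < q := by exact_mod_cast hq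
  have hs : (0 : ℝ) < (p : ℝ) / q := div_pos (by exact_mod_cast hp) hq0
  set s : ℝ := (p : ℝ) / q with hsdef
  set F : ℕ → ℝ := fun N => ((N : ℝ) * q - 1) * β ((N : ℝ) * p / ((N : ℝ) * q - 1))
    - (N : ℝ) * q * β s with hF
  have htop : Tendsto (fun N : ℕ => (N : ℝ) * q - 1) atTop atTop :=
    tendsto_atTop_add_const_right _ _ (tendsto_natCast_atTop_atTop.atTop_mul_const hq0)
  have hFlim : Tendsto F atTop (nhds (s * derivWithin β (Set.Ioi s) s - β s)) := by
    refine ((hconv.tendsto_mul_add_div_sub hs).comp htop).congr' ?_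
    filter_upwards [htop.eventually_gt_atTop 0] with N hN
    have harg : s + s / ((N : ℝ) * q - 1) = (N : ℝ) * p / ((N : ℝ) * q - 1) := by
      have hN0 := hN.ne'
      rw [hsdef, eq_div_iff hN0, add_mul, div_mul_cancel₀ _ hN0]
      field_simp
      ring
    simp only [Function.comp_apply, hF, harg]
    ring
  set c : ℕ → ℝ := fun N => if Even N then C else C' with hc
  have hmin (n : ℕ) : min |C| |C'| ≤ |c n| := by
    simp only [hc]; split_ifs
    exacts [min_le_left _ _, min_le_right _ _]
  have hmax (n : ℕ) : |c n| ≤ max |C| |C'| := by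
    simp only [hc]; split_ifs
    exacts [le_max_left _ _, le_max_right _ _]
  have hmpos : 0 < min |C| |C'| := lt_min (abs_pos.2 hC) (abs_pos.2 hC')
  have hexp : ∀ᶠ N : ℕ in atTop,
      |(F N - B) - c N * lam ^ N| ≤ K * lam ^ ((9 * (N : ℝ)) / 8) := by
    filter_upwards [eventually_ge_atTop N₀, eventually_ge_atTop 2] with N h0 h2
    have hFN : F N = AN h p q N - (N : ℝ) * cAction h q x := by
      rw [← hβN N h2, ← hβpq, ← mul_assoc]
    rw [hFN]
    rcases Nat.even_or_odd N with hN | hN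
    · simpa only [hc, if_pos hN] using heven N h0 hN
    · simpa only [hc, if_neg (Nat.not_even_iff_odd.2 hN)] using hodd N h0 hN
  have hbd := eventually_mul_pow_le_abs_and_abs_le hlam0 hlam1 hmpos hmin hmax hexp
  have hl := hbd.mono fun _ hN => hN.1
  have hu := hbd.mono fun _ hN => hN.2
  refine ⟨?_, tendsto_one_div_mul_log_abs_of_le_of_le hlam0 (half_pos hmpos) hl hu⟩
  have hzero : Tendsto (fun N => F N - B) atTop (nhds 0) := by
    refine squeeze_zero_norm' (by simpa only [Real.norm_eq_abs] using hu) ?_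
    simpa using (tendsto_pow_atTop_nhds_zero_of_lt_one hlam0.le hlam1).const_mul
      (max |C| |C'| + min |C| |C'| / 2)
  exact tendsto_nhds_unique (tendsto_sub_nhds_zero_iff.1 hzero) hFlim
end
end

section
/- (Finiteness of the Peierls barrier value for hyperbolic Aubry-Mather orbits.) Let h : ℝ × ℝ → ℝ be locally Lipschitz with h(x+1, x'+1) = h(x, x') for all x, x'. Let p, q be coprime positive integers, let x be a (p,q)-configuration with action A_{p,q} := Σ_{i=0}^{q−1} h(x_i, x_{i+1}), and let z be a configuration converging exponentially to x and its index-shift: there exist c > 0 and μ ∈ (0,1) such that |z_j − x_{j+1}| ≤ c·μ^{j/q} for all j ≥ 0 and |z_j − x_j| ≤ c·μ^{−j/q} for all j ≤ 0. Then the double limit B(z) := lim_{M,K→+∞} [ Σ_{i=−Kq+1}^{Mq−1} h(z_i, z_{i+1}) − (M+K)·A_{p,q} ] exists and is finite. -/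
noncomputable section

open Filter

theorem apply_add_int_of_diagonal_periodic {h : ℝ → ℝ → ℝ}
    (hper : ∀ a b : ℝ, h (a + 1) (b + 1) = h a b) (m : ℤ) (a b : ℝ) :
    h (a + m) (b + m) = h a b := by
  have hp : Function.Periodic (fun t => h (a + t) (b + t)) 1 := fun t => by
    simpa only [add_assoc] using hper (a + t) (b + t)
  simpa using hp.int_mul m 0

namespace IsConfigPQ

variable {p q : ℕ} {x : ℤ → ℝ}

theorem add_int_mul (hx : IsConfigPQ p q x) (i m : ℤ) :
    x (i + m * q) = x i + ((m * p : ℤ) : ℝ) := by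
  induction m with
  | zero => simp
  | succ n ih =>
    have := hx (i + n * q)
    rw [show i + ((n : ℤ) + 1) * q = i + n * q + q by ring, this, ih]
    push_cast; ring
  | pred n ih =>
    have := hx (i + (-n - 1) * q)
    rw [show i + (-(n : ℤ) - 1) * q + q = i + -n * q by ring, ih] at this
    push_cast at this ⊢; linarith

theorem periodic_step {h : ℝ → ℝ → ℝ} (hper : ∀ a b : ℝ, h (a + 1) (b + 1) = h a b)
    (hx : IsConfigPQ p q x) : Function.Periodic (fun i => h (x i) (x (i + 1))) (q : ℤ) := by
  intro i
  have h1 := hx (i + 1)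
  have h2 := apply_add_int_of_diagonal_periodic hper p (x i) (x (i + 1))
  rw [show i + 1 + (q : ℤ) = i + q + 1 by ring] at h1
  simp only [h1, hx i]
  exact_mod_cast h2

/-- A locally Lipschitz periodic `h` is Lipschitz at the points `(x i, x (i + 1))`,
uniformly in `i`. -/
theorem exists_uniform_lipschitz {h : ℝ → ℝ → ℝ}
    (hlip : LocallyLipschitz (fun u : ℝ × ℝ => h u.1 u.2))
    (hper : ∀ a b : ℝ, h (a + 1) (b + 1) = h a b) (hq : 0 < q) (hx : IsConfigPQ p q x) :
    ∃ L : ℝ, ∀ (i : ℤ) (a b δ : ℝ), |a - x i| ≤ δ → |b - x (i + 1)| ≤ δ → L * δ < 1 →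
      |h a b - h (x i) (x (i + 1))| ≤ L * δ := by
  have key : ∀ i : ℤ, ∀ᶠ L : ℝ in atTop, ∀ a b δ : ℝ, |a - x i| ≤ δ → |b - x (i + 1)| ≤ δ →
      L * δ < 1 → |h a b - h (x i) (x (i + 1))| ≤ L * δ := by
    intro i
    obtain ⟨K, s, hs, hK⟩ := hlip (x i, x (i + 1))
    obtain ⟨ε, hε, hball⟩ := Metric.mem_nhds_iff.1 hs
    filter_upwards [eventually_ge_atTop (K : ℝ), eventually_ge_atTop ε⁻¹]
      with L hLK hLε a b δ ha hb hδ
    have hδ0 : 0 ≤ δ := (abs_nonneg _).trans ha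
    have hδε : δ < ε := by
      have : ε⁻¹ * δ < 1 := (mul_le_mul_of_nonneg_right hLε hδ0).trans_lt hδ
      rwa [inv_mul_lt_iff₀ hε, mul_one] at this
    have hd : dist (a, b) (x i, x (i + 1)) ≤ δ := by
      simp only [Prod.dist_eq, Real.dist_eq]
      exact max_le ha hb
    have h1 := hK.dist_le_mul (a, b) (hball (hd.trans_lt hδε)) _
      (hball (Metric.mem_ball_self hε))
    rw [Real.dist_eq] at h1
    exact h1.trans (mul_le_mul hLK hd dist_nonneg (K.coe_nonneg.trans hLK))
  have hall := (Finset.eventually_all (Finset.Ico (0 : ℤ) q)).2 fun i _ => key i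
  obtain ⟨L, hL⟩ := hall.exists
  refine ⟨L, fun i a b δ ha hb hδ => ?_⟩
  have hq' : (0 : ℤ) < q := by exact_mod_cast hq
  have hmod : i = i % q + i / q * q := by rw [mul_comm]; exact (Int.emod_add_mul_ediv i q).symm
  set r := i % q
  set m := i / (q : ℤ)
  have e1 : x i = x r + ((m * p : ℤ) : ℝ) := by rw [hmod, hx.add_int_mul]
  have e2 : x (i + 1) = x (r + 1) + ((m * p : ℤ) : ℝ) := by
    rw [hmod, add_right_comm, hx.add_int_mul]
  have hr := hL r (Finset.mem_Ico.2 ⟨Int.emod_nonneg _ hq'.ne', Int.emod_lt_of_pos _ hq'⟩)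
    (a - (m * p : ℤ)) (b - (m * p : ℤ)) δ (by rwa [sub_sub, add_comm, ← e1])
    (by rwa [sub_sub, add_comm, ← e2]) hδ
  have hab := apply_add_int_of_diagonal_periodic hper (m * p) (a - (m * p : ℤ)) (b - (m * p : ℤ))
  rw [sub_add_cancel, sub_add_cancel] at hab
  rwa [e1, e2, apply_add_int_of_diagonal_periodic hper, hab]

/-- Step actions along a sequence converging geometrically to a `(p,q)`-configuration differ
summably from those of the configuration. -/
theorem summable_step_sub {h : ℝ → ℝ → ℝ}
    (hlip : LocallyLipschitz (fun u : ℝ × ℝ => h u.1 u.2))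
    (hper : ∀ a b : ℝ, h (a + 1) (b + 1) = h a b) (hq : 0 < q) (hx : IsConfigPQ p q x)
    {k : ℕ → ℤ} {a b : ℕ → ℝ} {c r : ℝ} (hr0 : 0 ≤ r) (hr1 : r < 1)
    (ha : ∀ n, |a n - x (k n)| ≤ c * r ^ n) (hb : ∀ n, |b n - x (k n + 1)| ≤ c * r ^ n) :
    Summable fun n => h (a n) (b n) - h (x (k n)) (x (k n + 1)) := by
  obtain ⟨L, hL⟩ := hx.exists_uniform_lipschitz hlip hper hq
  have hs : Summable fun n : ℕ => L * (c * r ^ n) :=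
    ((summable_geometric_of_lt_one hr0 hr1).mul_left c).mul_left L
  refine hs.of_norm_bounded_eventually_nat ?_
  filter_upwards [hs.tendsto_atTop_zero.eventually_lt_const one_pos] with n hn
  exact hL _ _ _ _ (ha n) (hb n) hn

end IsConfigPQ

theorem Function.Periodic.sum_range_mul {f : ℕ → ℝ} {q : ℕ} (hf : Function.Periodic f q) (M : ℕ) :
    ∑ n ∈ Finset.range (M * q), f n = M * ∑ n ∈ Finset.range q, f n := by
  induction M with
  | zero => simp
  | succ M ih =>
    have : ∀ n, f (M * q + n) = f n := fun n => by
      rw [add_comm]; exact hf.nat_mul M n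
    rw [Nat.succ_mul, Finset.sum_range_add, ih, Finset.sum_congr rfl fun n _ => this n]
    push_cast; ring

theorem sum_Ico_neg_eq_sum_range_add (f : ℤ → ℝ) (K M : ℕ) :
    ∑ i ∈ Finset.Ico (-K : ℤ) M, f i =
      ∑ n ∈ Finset.range M, f n + ∑ n ∈ Finset.range K, f (-(n + 1 : ℤ)) := by
  induction M with
  | zero =>
    induction K with
    | zero => simp
    | succ K ih =>
      have : Finset.Ico (-(K + 1 : ℕ) : ℤ) (0 : ℕ) =
          insert (-(K + 1 : ℤ)) (Finset.Ico (-K : ℤ) (0 : ℕ)) := by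
        ext i; simp only [Finset.mem_insert, Finset.mem_Ico]; lia
      rw [this, Finset.sum_insert (by simp), ih, Finset.sum_range_succ]
      ring
  | succ M ih =>
    have : Finset.Ico (-K : ℤ) (M + 1 : ℕ) = insert (M : ℤ) (Finset.Ico (-K : ℤ) M) := by
      ext i; simp only [Finset.mem_insert, Finset.mem_Ico]; lia
    rw [this, Finset.sum_insert (by simp), ih, Finset.sum_range_succ]
    ring

/-- finiteness of the Peierls barrier value: if `h` is locally
Lipschitz and periodic, `x` is a `(p,q)`-configuration with action `A_{p,q}`,
and `z` converges exponentially (`|z_j − x_{j+1}| ≤ c·μ^{j/q}` for `j ≥ 0`,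
`|z_j − x_j| ≤ c·μ^{−j/q}` for `j ≤ 0`, with `c > 0`, `0 < μ < 1`), then the
double limit defining the Peierls barrier value `B(z)` exists and is finite. -/
theorem stmt_5 (h : ℝ → ℝ → ℝ)
    (hlip : LocallyLipschitz (fun u : ℝ × ℝ => h u.1 u.2))
    (hper : ∀ a b : ℝ, h (a + 1) (b + 1) = h a b)
    (p q : ℕ) (hp : 0 < p) (hq : 0 < q) (hcop : Nat.Coprime p q)
    (x : ℤ → ℝ) (hxpq : IsConfigPQ p q x)
    (z : ℤ → ℝ) (c μ : ℝ) (hc : 0 < c) (hμ0 : 0 < μ) (hμ1 : μ < 1)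
    (hfwd : ∀ j : ℤ, 0 ≤ j → |z j - x (j + 1)| ≤ c * μ ^ ((j : ℝ) / q))
    (hbwd : ∀ j : ℤ, j ≤ 0 → |z j - x j| ≤ c * μ ^ ((-(j : ℝ)) / q)) :
    ∃ B : ℝ, HasBarrierValue h q (cAction h q x) z B := by
  have hq0 : (0 : ℝ) < q := by exact_mod_cast hq
  set φ : ℤ → ℝ := fun i => h (x i) (x (i + 1)) with hφ
  have hφper : Function.Periodic φ q := hxpq.periodic_step hper
  set r : ℝ := μ ^ (1 / q : ℝ)
  have hr0 : 0 < r := Real.rpow_pos_of_pos hμ0 _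
  have hr1 : r < 1 := Real.rpow_lt_one hμ0.le hμ1 (by positivity)
  have hpow : ∀ n : ℕ, μ ^ ((n : ℝ) / q) = r ^ n := fun n => by
    rw [← Real.rpow_mul_natCast hμ0.le]; ring_nf
  have hmono : ∀ n : ℕ, c * r ^ (n + 1) ≤ c * r ^ n := fun n =>
    mul_le_mul_of_nonneg_left (pow_le_pow_of_le_one hr0.le hr1.le n.le_succ) hc.le
  have hfwd' : ∀ n : ℕ, |z n - x (n + 1)| ≤ c * r ^ n := fun n => by
    simpa [hpow] using hfwd n (by positivity)
  have hbwd' : ∀ n : ℕ, |z (-n) - x (-n)| ≤ c * r ^ n := fun n => by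
    simpa [hpow] using hbwd (-n) (by simp)
  have hf := hxpq.summable_step_sub hlip hper hq (k := fun n => n + 1) (a := fun n => z n)
    (b := fun n => z (n + 1)) hr0.le hr1 hfwd'
    fun n => by simpa using (hfwd' (n + 1)).trans (hmono n)
  have hg := hxpq.summable_step_sub hlip hper hq (k := fun n => -(n + 1))
    (a := fun n => z (-(n + 1))) (b := fun n => z (-(n + 1) + 1)) hr0.le hr1
    (fun n => by simpa using (hbwd' (n + 1)).trans (hmono n))
    fun n => by simpa using hbwd' n
  set f : ℕ → ℝ := fun n => h (z n) (z (n + 1)) - h (x (n + 1)) (x (n + 1 + 1)) with hfdef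
  set g : ℕ → ℝ := fun n => h (z (-(n + 1))) (z (-(n + 1) + 1)) -
    h (x (-(n + 1))) (x (-(n + 1) + 1)) with hgdef
  have hA : cAction h q x = ∑ n ∈ Finset.range q, φ n := by
    have := sum_Ico_neg_eq_sum_range_add φ 0 q
    simpa [cAction] using this
  have hsumf : ∀ M : ℕ, ∑ n ∈ Finset.range (M * q), φ (n + 1) = M * cAction h q x := by
    intro M
    have hper' : Function.Periodic (fun n : ℕ => φ (n + 1)) q := fun n => by
      have := hφper (n + 1)
      simpa [add_right_comm] using this
    rw [hper'.sum_range_mul, hA]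
    congr 1
    have h1 := Finset.sum_range_succ (fun n : ℕ => φ n) q
    have h2 := Finset.sum_range_succ' (fun n : ℕ => φ n) q
    have h3 : φ q = φ 0 := hφper.eq
    push_cast at h1 h2
    linarith
  have hsumg : ∀ K : ℕ, ∑ n ∈ Finset.range (K * q), φ (-(n + 1)) = K * cAction h q x := by
    intro K
    have hper' : Function.Periodic (fun n : ℕ => φ (-(n + 1))) q := fun n => by
      have := hφper.sub_eq (-(n + 1))
      simp only [← this]
      push_cast
      ring_nf
    rw [hper'.sum_range_mul, hA, ← Finset.sum_range_reflect (fun n : ℕ => φ n)]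
    congr 1
    refine Finset.sum_congr rfl fun n hn => ?_
    rw [← hφper]
    congr 1
    have := Finset.mem_range.1 hn
    lia
  have hMq : Tendsto (fun n : ℕ => n * q) atTop atTop :=
    tendsto_id.atTop_mul_const' hq
  have hM : Tendsto (fun MK : ℕ × ℕ => MK.1 * q) atTop atTop := by
    rw [← prod_atTop_atTop_eq]; exact hMq.comp tendsto_fst
  have hK : Tendsto (fun MK : ℕ × ℕ => MK.2 * q) atTop atTop := by
    rw [← prod_atTop_atTop_eq]; exact hMq.comp tendsto_snd
  refine ⟨∑' n, f n + ∑' n, g n - 0 - φ 0, ?_⟩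
  refine ((((hf.hasSum.tendsto_sum_nat.comp hM).add
    (hg.hasSum.tendsto_sum_nat.comp hK)).sub (hg.tendsto_atTop_zero.comp
      ((tendsto_sub_atTop_nat 1).comp hK))).sub_const (φ 0)).congr' ?_
  filter_upwards [hK.eventually_ge_atTop 1] with ⟨M, K⟩ hKq
  dsimp only at hKq
  have hsplit : Finset.Ico (-(K * q : ℕ) : ℤ) (M * q : ℕ) =
      insert (-(K * q : ℕ) : ℤ) (Finset.Icc (-((K : ℤ) * q) + 1) ((M : ℤ) * q - 1)) := by
    ext i
    simp only [Finset.mem_insert, Finset.mem_Ico, Finset.mem_Icc]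
    push_cast
    have : (1 : ℤ) ≤ K * q := by exact_mod_cast hKq
    have : (0 : ℤ) ≤ M * q := by positivity
    lia
  have hsum := sum_Ico_neg_eq_sum_range_add (fun i => h (z i) (z (i + 1))) (K * q) (M * q)
  rw [hsplit, Finset.sum_insert (by simp)] at hsum
  have hlast : g (K * q - 1) =
      h (z (-(K * q : ℕ))) (z (-(K * q : ℕ) + 1)) - φ 0 := by
    have h0 : φ (-(K * q : ℕ)) = φ 0 := by
      have := hφper.int_mul (-K) 0
      simpa using this
    have h1 : ((K * q - 1 : ℕ) : ℤ) + 1 = (K * q : ℕ) := by lia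
    simp only [hgdef, h1]
    rw [← h0]
  have hF := hsumf M
  have hG := hsumg K
  simp only [Function.comp_apply, hlast]
  simp only [hfdef, hgdef, Finset.sum_sub_distrib]
  simp only [hφ] at hF hG ⊢
  linarith
end
end

section
/- (Lemma 6.2, C^{1,1/2} normal form at a hyperbolic fixed point.) Let g be a C² diffeomorphism from a neighborhood of a point P ∈ ℝ² onto its image, with g(P) = P, preserving area (det Dg ≡ 1 on its domain), and such that Dg(P) has eigenvalues λ and λ^{−1} for some 0 < λ < 1. Then for every ε > 0 there exist open neighborhoods U, V of P and a C^{1,1/2} diffeomorphism Φ : V → U with Φ(P) = P such that Φ^{−1}(g(Φ(w))) = P + Dg(P)(w − P) for all w in a neighborhood of P contained in V, with ‖Φ − Id‖_{C¹} ≤ ε and ‖Φ^{−1} − Id‖_{C¹} ≤ ε; moreover there exists a constant M ≥ 0 such that |Φ(w) − Φ(w') − (w − w')| ≤ M · max(|w − P|^{1/2}, |w' − P|^{1/2}) · |w − w'| for all w, w' ∈ V. -/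
noncomputable section

/-- A map is `C^{1,1/2}` on a set if it is continuously differentiable there with
`1/2`-Hölder continuous derivative. -/
def C1Half (Φ : ℝ × ℝ → ℝ × ℝ) (V : Set (ℝ × ℝ)) : Prop :=
  ContDiffOn ℝ 1 Φ V ∧
  ∃ M : NNReal, HolderOnWith M (1 / 2 : NNReal) (fun w => fderivWithin ℝ Φ V w) V

open Filter Asymptotics Topology

/-- A map is differentiable near `p` with an `α`-Hölder derivative there. -/
def HolderDiffAt {E F : Type*} [NormedAddCommGroup E] [NormedSpace ℝ E] [NormedAddCommGroup F]
    [NormedSpace ℝ F] (α : ℝ) (f : E → F) (p : E) : Prop :=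
  (∀ᶠ x in 𝓝 p, DifferentiableAt ℝ f x) ∧
    (fun z : E × E => fderiv ℝ f z.1 - fderiv ℝ f z.2) =O[𝓝 (p, p)] fun z => ‖z.1 - z.2‖ ^ α

namespace HolderDiffAt

variable {E F G : Type*} [NormedAddCommGroup E] [NormedSpace ℝ E] [NormedAddCommGroup F]
  [NormedSpace ℝ F] [NormedAddCommGroup G] [NormedSpace ℝ G] {α : ℝ} {f : E → F} {p : E}

theorem of_contDiffAt (h : ContDiffAt ℝ 2 f p) : HolderDiffAt 1 f p := by
  refine ⟨(h.eventually (by simp)).mono fun x hx => hx.differentiableAt (by simp), ?_⟩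
  have h1 : ContDiffAt ℝ 1 (fderiv ℝ f) p := h.fderiv_right (by norm_num)
  simpa using (h1.hasStrictFDerivAt (by simp)).isBigO_sub.norm_right

theorem of_eventually {f' : E → E →L[ℝ] F} {K : ℝ} (h : ∀ᶠ x in 𝓝 p, HasFDerivAt f (f' x) x)
    (hK : ∀ᶠ z : E × E in 𝓝 (p, p), ‖f' z.1 - f' z.2‖ ≤ K * ‖z.1 - z.2‖ ^ α) :
    HolderDiffAt α f p := by
  refine ⟨h.mono fun x hx => hx.differentiableAt, IsBigO.of_bound K ?_⟩
  have h2 : ∀ᶠ z : E × E in 𝓝 (p, p), HasFDerivAt f (f' z.1) z.1 ∧ HasFDerivAt f (f' z.2) z.2 := by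
    rw [nhds_prod_eq]
    exact h.prod_mk h
  filter_upwards [h2, hK] with z hz hz'
  rw [hz.1.fderiv, hz.2.fderiv, Real.norm_of_nonneg (by positivity)]
  exact hz'

theorem continuousAt_fderiv (hα : 0 < α) (h : HolderDiffAt α f p) :
    ContinuousAt (fderiv ℝ f) p := by
  have h1 : Tendsto (fun x : E => (x, p)) (𝓝 p) (𝓝 (p, p)) :=
    (continuous_id.prodMk continuous_const).tendsto' _ _ rfl
  have h2 := h.2.comp_tendsto h1
  have h3 : Tendsto (fun x => ‖x - p‖ ^ α) (𝓝 p) (𝓝 0) := by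
    have : Continuous fun x => ‖x - p‖ ^ α := by fun_prop (disch := exact hα.le)
    exact this.tendsto' _ _ (by simp [hα.ne'])
  have h4 := h2.trans_tendsto h3
  exact tendsto_sub_nhds_zero_iff.1 h4

theorem hasStrictFDerivAt (hα : 0 < α) (h : HolderDiffAt α f p) :
    HasStrictFDerivAt f (fderiv ℝ f p) p :=
  hasStrictFDerivAt_of_hasFDerivAt_of_continuousAt (h.1.mono fun _ hx => hx.hasFDerivAt)
    (h.continuousAt_fderiv hα)

theorem tendsto_prodMap {X Y : Type*} [TopologicalSpace X] [TopologicalSpace Y] {f : X → Y}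
    {p : X} (h : ContinuousAt f p) :
    Tendsto (fun z : X × X => (f z.1, f z.2)) (𝓝 (p, p)) (𝓝 (f p, f p)) := by
  rw [nhds_prod_eq, nhds_prod_eq]
  exact h.tendsto.prodMap h.tendsto

theorem comp (hα : 0 < α) {g : F → G} (hg : HolderDiffAt α g (f p)) (hf : HolderDiffAt α f p) :
    HolderDiffAt α (g ∘ f) p := by
  have hfs := hf.hasStrictFDerivAt hα
  have hgs := hg.hasStrictFDerivAt hα
  have hfc : ContinuousAt f p := hfs.continuousAt
  have hg1 := hfc.eventually hg.1
  refine ⟨(hf.1.and hg1).mono fun x hx => hx.2.comp x hx.1, ?_⟩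
  have key : ∀ᶠ x in 𝓝 p, fderiv ℝ (g ∘ f) x = (fderiv ℝ g (f x)).comp (fderiv ℝ f x) :=
    (hf.1.and hg1).mono fun x hx => fderiv_comp x hx.2 hx.1
  have key2 : ∀ᶠ z : E × E in 𝓝 (p, p), fderiv ℝ (g ∘ f) z.1 - fderiv ℝ (g ∘ f) z.2 =
      (fderiv ℝ g (f z.1)).comp (fderiv ℝ f z.1 - fderiv ℝ f z.2) +
        (fderiv ℝ g (f z.1) - fderiv ℝ g (f z.2)).comp (fderiv ℝ f z.2) := by
    rw [nhds_prod_eq]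
    filter_upwards [key.prod_mk key] with z hz
    rw [hz.1, hz.2]
    ext v
    simp
  have b1 : (fun z : E × E => fderiv ℝ g (f z.1)) =O[𝓝 (p, p)] fun _ => (1 : ℝ) :=
    (((hg.continuousAt_fderiv hα).comp hfc).tendsto.comp (continuous_fst.tendsto (p, p))).isBigO_one
      ℝ
  have b2 : (fun z : E × E => fderiv ℝ f z.2) =O[𝓝 (p, p)] fun _ => (1 : ℝ) :=
    ((hf.continuousAt_fderiv hα).tendsto.comp (continuous_snd.tendsto (p, p))).isBigO_one ℝ
  have b3 : (fun z : E × E => fderiv ℝ g (f z.1) - fderiv ℝ g (f z.2)) =O[𝓝 (p, p)]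
      fun z => ‖z.1 - z.2‖ ^ α :=
    (hg.2.comp_tendsto (tendsto_prodMap hfc)).trans
      (hfs.isBigO_sub.norm_norm.rpow hα.le (Eventually.of_forall fun _ => norm_nonneg _))
  have c1 := b1.norm_left.mul hf.2.norm_left
  have c2 := b3.norm_left.mul b2.norm_left
  simp only [one_mul, mul_one] at c1 c2
  refine IsBigO.congr' ?_ (key2.mono fun z hz => hz.symm) EventuallyEq.rfl
  refine IsBigO.add (IsBigO.trans (IsBigO.of_norm_le fun z => ?_) c1)
    (IsBigO.trans (IsBigO.of_norm_le fun z => ?_) c2)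
  · exact ContinuousLinearMap.opNorm_comp_le _ _
  · exact ContinuousLinearMap.opNorm_comp_le _ _

theorem congr {f₁ : E → F} (hf : HolderDiffAt α f p) (h : f₁ =ᶠ[𝓝 p] f) :
    HolderDiffAt α f₁ p := by
  refine ⟨?_, ?_⟩
  · filter_upwards [hf.1, h.eventually_nhds] with x hx hx'
    exact hx.congr_of_eventuallyEq hx'
  · refine hf.2.congr' ?_ EventuallyEq.rfl
    have := h.fderiv (𝕜 := ℝ)
    rw [nhds_prod_eq]
    filter_upwards [this.prod_mk this] with z hz
    rw [hz.1, hz.2]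

theorem of_le (hα : 0 < α) (h : HolderDiffAt 1 f p) (h1 : α ≤ 1) : HolderDiffAt α f p := by
  refine ⟨h.1, h.2.trans (IsBigO.of_bound 1 ?_)⟩
  have : ∀ᶠ z : E × E in 𝓝 (p, p), ‖z.1 - z.2‖ < 1 := by
    have hc : Continuous fun z : E × E => ‖z.1 - z.2‖ := by fun_prop
    exact hc.continuousAt.eventually_lt continuousAt_const (by simp)
  filter_upwards [this] with z hz
  rw [one_mul, Real.norm_of_nonneg (by positivity), Real.norm_of_nonneg (by positivity)]
  exact Real.rpow_le_rpow_of_exponent_ge' (norm_nonneg _) hz.le hα.le h1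

theorem localInverse [CompleteSpace E] (hα : 0 < α) {A : E ≃L[ℝ] F}
    (hf : HolderDiffAt α f p) (hA : fderiv ℝ f p = (A : E →L[ℝ] F)) {g : F → E} {q : F}
    (hgq : g q = p)
    (hg : ∀ᶠ y in 𝓝 q, ContinuousAt g y) (hfg : ∀ᶠ y in 𝓝 q, f (g y) = y) :
    HolderDiffAt α g q := by
  have hgc : Tendsto g (𝓝 q) (𝓝 p) := by
    have := hg.self_of_nhds.tendsto
    rwa [hgq] at this
  have hF : Tendsto (fun y => fderiv ℝ f (g y)) (𝓝 q) (𝓝 (A : E →L[ℝ] F)) := by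
    rw [← hA]
    exact (hf.continuousAt_fderiv hα).tendsto.comp hgc
  have key : ∀ᶠ y in 𝓝 q,
      HasFDerivAt g (ContinuousLinearMap.inverse (fderiv ℝ f (g y))) y := by
    filter_upwards [hg, hfg.eventually_nhds, hF.eventually A.nhds, hgc.eventually hf.1]
      with y h1 h2 ⟨B, hB⟩ h4
    rw [← hB, ContinuousLinearMap.inverse_equiv]
    refine HasFDerivAt.of_local_left_inverse (f := f) h1 ?_ h2
    rw [hB]
    exact h4.hasFDerivAt
  refine ⟨key.mono fun y hy => hy.differentiableAt, ?_⟩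
  have i1 := (contDiffAt_map_inverse (𝕜 := ℝ) (n := 1) A).hasStrictFDerivAt (by simp)
  have t1 : Tendsto (fun z : F × F => (fderiv ℝ f (g z.1), fderiv ℝ f (g z.2))) (𝓝 (q, q))
      (𝓝 ((A : E →L[ℝ] F), (A : E →L[ℝ] F))) := by
    rw [nhds_prod_eq, nhds_prod_eq]
    exact hF.prodMap hF
  have t2 : Tendsto (fun z : F × F => (g z.1, g z.2)) (𝓝 (q, q)) (𝓝 (p, p)) := by
    rw [nhds_prod_eq, nhds_prod_eq]
    exact hgc.prodMap hgc
  have hfs := hf.hasStrictFDerivAt hα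
  have hgs : HasStrictFDerivAt g (A.symm : F →L[ℝ] E) q := by
    refine HasStrictFDerivAt.of_local_left_inverse hg.self_of_nhds ?_ hfg
    rw [hgq, ← hA]
    exact hfs
  have i2 := (i1.isBigO_sub.comp_tendsto t1).trans ((hf.2.comp_tendsto t2).trans
    (hgs.isBigO_sub.norm_norm.rpow hα.le (Eventually.of_forall fun _ => norm_nonneg _)))
  refine i2.congr' ?_ EventuallyEq.rfl
  rw [nhds_prod_eq]
  filter_upwards [key.prod_mk key] with z hz
  simp only [Function.comp]
  rw [hz.1.fderiv, hz.2.fderiv]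

theorem exists_localInverse [CompleteSpace E] (hα : 0 < α) {A : E ≃L[ℝ] F}
    (hf : HolderDiffAt α f p) (hA : fderiv ℝ f p = (A : E →L[ℝ] F)) :
    ∃ e : OpenPartialHomeomorph E F, (e : E → F) = f ∧ p ∈ e.source ∧
      HolderDiffAt α e.symm (f p) ∧ HasFDerivAt e.symm (A.symm : F →L[ℝ] E) (f p) := by
  have hfs := hf.hasStrictFDerivAt hα
  rw [hA] at hfs
  set e := hfs.toOpenPartialHomeomorph f with he
  have hes : p ∈ e.source := hfs.mem_toOpenPartialHomeomorph_source
  have hef : (e : E → F) = f := rfl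
  have het : f p ∈ e.target := e.map_source hes
  have hgq : e.symm (f p) = p := e.left_inv hes
  have ht := e.open_target.mem_nhds het
  have h1 : ∀ᶠ y in 𝓝 (f p), ContinuousAt e.symm y := by
    filter_upwards [ht] with y hy
    exact e.symm.continuousAt hy
  have h2 : ∀ᶠ y in 𝓝 (f p), f (e.symm y) = y := by
    filter_upwards [ht] with y hy
    exact e.right_inv hy
  refine ⟨e, hef, hes, hf.localInverse hα hA hgq h1 h2, ?_⟩
  refine HasFDerivAt.of_local_left_inverse (f := f) h1.self_of_nhds ?_ h2
  rw [hgq]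
  exact hfs.hasFDerivAt

theorem exists_ball (h : HolderDiffAt α f p) : ∃ r > 0, ∃ K > 0,
    (∀ x ∈ Metric.ball p r, DifferentiableAt ℝ f x) ∧
    ∀ x ∈ Metric.ball p r, ∀ y ∈ Metric.ball p r,
      ‖fderiv ℝ f x - fderiv ℝ f y‖ ≤ K * ‖x - y‖ ^ α := by
  obtain ⟨K, hK, hb⟩ := h.2.exists_pos
  have hb := hb.bound
  obtain ⟨r₁, hr₁, h₁⟩ := Metric.eventually_nhds_iff_ball.1 h.1
  obtain ⟨r₂, hr₂, h₂⟩ := Metric.eventually_nhds_iff_ball.1 hb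
  refine ⟨min r₁ r₂, lt_min hr₁ hr₂, K, hK, fun x hx => h₁ x ?_, fun x hx y hy => ?_⟩
  · exact Metric.ball_subset_ball (min_le_left _ _) hx
  · have := h₂ (x, y) (by
      rw [← ball_prod_same]
      exact ⟨Metric.ball_subset_ball (min_le_right _ _) hx,
        Metric.ball_subset_ball (min_le_right _ _) hy⟩)
    rwa [Real.norm_of_nonneg (by positivity)] at this

end HolderDiffAt

theorem exists_limit_hasFDerivAt {E F : Type*} [NormedAddCommGroup E] [NormedSpace ℝ E]
    [NormedAddCommGroup F] [NormedSpace ℝ F] [CompleteSpace F] {s : Set E} (hs : IsOpen s)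
    (hs' : IsPreconnected s) {f : ℕ → E → F} {f' : ℕ → E → E →L[ℝ] F}
    (hf : ∀ n, ∀ x ∈ s, HasFDerivAt (f n) (f' n x) x) {D θ : ℝ} (hθ₀ : 0 ≤ θ) (hθ : θ < 1)
    (hf' : ∀ n, ∀ x ∈ s, ‖f' (n + 1) x - f' n x‖ ≤ D * θ ^ n) {x₀ : E} (hx₀ : x₀ ∈ s)
    (hfx₀ : ∀ n, f n x₀ = f 0 x₀) :
    ∃ (g : E → F) (g' : E → E →L[ℝ] F), ∀ x ∈ s, HasFDerivAt g (g' x) x ∧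
      Tendsto (fun n => f n x) atTop (𝓝 (g x)) ∧ Tendsto (fun n => f' n x) atTop (𝓝 (g' x)) := by
  have hu : Summable fun n => D * θ ^ n := (summable_geometric_of_lt_one hθ₀ hθ).mul_left D
  have hd : ∀ n, ∀ x ∈ s, HasFDerivAt (fun x => f (n + 1) x - f n x) (f' (n + 1) x - f' n x) x :=
    fun n x hx => (hf (n + 1) x hx).sub (hf n x hx)
  have hd₀ : Summable fun n => f (n + 1) x₀ - f n x₀ := by
    simp only [hfx₀, sub_self]
    exact summable_zero
  have hsum' : ∀ x ∈ s, Summable fun n => f' (n + 1) x - f' n x := fun x hx =>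
    Summable.of_norm_bounded hu fun n => hf' n x hx
  refine ⟨fun x => f 0 x + ∑' n, (f (n + 1) x - f n x),
    fun x => f' 0 x + ∑' n, (f' (n + 1) x - f' n x), fun x hx => ⟨?_, ?_, ?_⟩⟩
  · exact (hf 0 x hx).add (hasFDerivAt_tsum_of_isPreconnected hu hs hs' hd hf' hx₀ hd₀ hx)
  · have := (summable_of_summable_hasFDerivAt_of_isPreconnected hu hs hs' hd hf' hx₀ hd₀
      hx).hasSum.tendsto_sum_nat.const_add (f 0 x)
    simpa [Finset.sum_range_sub (fun n => f n x)] using this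
  · have := (hsum' x hx).hasSum.tendsto_sum_nat.const_add (f' 0 x)
    simpa [Finset.sum_range_sub (fun n => f' n x)] using this

theorem norm_comp_sub_comp_le {E F G : Type*} [NormedAddCommGroup E] [NormedSpace ℝ E]
    [NormedAddCommGroup F] [NormedSpace ℝ F] [NormedAddCommGroup G] [NormedSpace ℝ G]
    (A A' : F →L[ℝ] G) (B B' : E →L[ℝ] F) :
    ‖A.comp B - A'.comp B'‖ ≤ ‖A - A'‖ * ‖B‖ + ‖A'‖ * ‖B - B'‖ := by
  have : A.comp B - A'.comp B' = (A - A').comp B + A'.comp (B - B') := by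
    ext v
    simp
  rw [this]
  exact (norm_add_le _ _).trans
    (add_le_add (ContinuousLinearMap.opNorm_comp_le _ _) (ContinuousLinearMap.opNorm_comp_le _ _))

section Curve

variable {E : Type*} [NormedAddCommGroup E] [NormedSpace ℝ E]

/-- The curves `t ↦ G^n (μ⁻ⁿ t e)`. -/
def unstableCurveSeq (G : E → E) (μ : ℝ) (e : E) : ℕ → ℝ → E
  | 0 => fun t => t • e
  | n + 1 => fun t => G (unstableCurveSeq G μ e n (μ⁻¹ * t))

/-- The derivatives of `unstableCurveSeq`. -/
def unstableCurveSeqDeriv (G : E → E) (μ : ℝ) (e : E) : ℕ → ℝ → ℝ →L[ℝ] E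
  | 0 => fun _ => ContinuousLinearMap.toSpanSingleton ℝ e
  | n + 1 => fun t => μ⁻¹ • (fderiv ℝ G (unstableCurveSeq G μ e n (μ⁻¹ * t))).comp
      (unstableCurveSeqDeriv G μ e n (μ⁻¹ * t))

/-- A fixed point whose linear part has `μ > 1` as top expansion rate, realized by the
eigenvector `e`, has a `C^{1,1}` invariant curve tangent to `e` on which the map is linear. -/
theorem exists_unstable_curve [CompleteSpace E] {G : E → E} (hG : HolderDiffAt 1 G 0)
    (hG0 : G 0 = 0)
    {μ : ℝ} (hμ : 1 < μ) (hnorm : ‖fderiv ℝ G 0‖ ≤ μ) {e : E} (he1 : ‖e‖ = 1)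
    (he : fderiv ℝ G 0 e = μ • e) :
    ∃ γ : ℝ → E, HolderDiffAt 1 γ 0 ∧ γ 0 = 0 ∧
      HasFDerivAt γ (ContinuousLinearMap.toSpanSingleton ℝ e) 0 ∧
      ∀ᶠ t in 𝓝 0, G (γ t) = γ (μ * t) := by
  obtain ⟨r, hr, C, hC, hdiff, hlip⟩ := hG.exists_ball
  simp only [Real.rpow_one] at hlip
  have hμ0 : 0 < μ := by linarith
  obtain ⟨l, hl⟩ : ∃ l, l = μ⁻¹ := ⟨_, rfl⟩
  have hl0 : 0 < l := hl ▸ inv_pos.2 hμ0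
  have hl1 : l < 1 := hl ▸ inv_lt_one_of_one_lt₀ hμ
  have hlμ : l * μ = 1 := by rw [hl, inv_mul_cancel₀ hμ0.ne']
  obtain ⟨K, hKdef⟩ : ∃ K, K = 6 * C / (1 - l) := ⟨_, rfl⟩
  have h1l : 0 < 1 - l := by linarith
  have hK : 0 < K := by rw [hKdef]; positivity
  have hKC : 6 * C = (1 - l) * K := by rw [hKdef]; field_simp
  obtain ⟨ρ, hρ, hρr, hρK, hρC⟩ : ∃ ρ > 0, 2 * ρ ≤ r ∧ K * ρ ≤ 1 ∧ 4 * C * ρ ≤ (1 - l) / 2 := by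
    refine ⟨min (r / 2) (min (1 / K) ((1 - l) / (8 * C))), by positivity, ?_, ?_, ?_⟩
    · linarith [min_le_left (r / 2) (min (1 / K) ((1 - l) / (8 * C)))]
    · have := (min_le_right (r / 2) (min (1 / K) ((1 - l) / (8 * C)))).trans (min_le_left _ _)
      calc K * _ ≤ K * (1 / K) := by gcongr
        _ = 1 := by field_simp
    · have := (min_le_right (r / 2) (min (1 / K) ((1 - l) / (8 * C)))).trans (min_le_right _ _)
      calc 4 * C * _ ≤ 4 * C * ((1 - l) / (8 * C)) := by gcongr
        _ = (1 - l) / 2 := by field_simp; norm_num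
  set s := Metric.ball (0 : ℝ) ρ with hs
  set γ := unstableCurveSeq G μ e with hγ
  set γ' := unstableCurveSeqDeriv G μ e with hγ'
  set e' := ContinuousLinearMap.toSpanSingleton ℝ e with he'
  have hγs : ∀ n t, γ (n + 1) t = G (γ n (l * t)) := fun n t => by rw [hl]; rfl
  have hγs' : ∀ n t, γ' (n + 1) t = l • (fderiv ℝ G (γ n (l * t))).comp (γ' n (l * t)) :=
    fun n t => by rw [hl]; rfl
  have hls : ∀ t ∈ s, l * t ∈ s := fun t ht => by
    simp only [hs, mem_ball_zero_iff, Real.norm_eq_abs, abs_mul, abs_of_pos hl0] at ht ⊢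
    nlinarith [abs_nonneg t]
  have hsm : ∀ A B : ℝ →L[ℝ] E, ‖l • A - l • B‖ = l * ‖A - B‖ := fun A B => by
    have : l • A - l • B = l • (A - B) := by
      ext
      simp [smul_sub]
    rw [this, norm_smul, Real.norm_of_nonneg hl0.le]
  have h0s : (0 : ℝ) ∈ s := by simpa [hs] using hρ
  have hbnd : ∀ n, (∀ t ∈ s, HasFDerivAt (γ n) (γ' n t) t) ∧ γ n 0 = 0 ∧ γ' n 0 = e' ∧
      (∀ t ∈ s, ∀ u ∈ s, ‖γ' n t - γ' n u‖ ≤ K * |t - u|) →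
      (∀ t ∈ s, ‖γ' n t‖ ≤ 2) ∧ (∀ t ∈ s, ∀ u ∈ s, ‖γ n t - γ n u‖ ≤ 2 * |t - u|) ∧
      (∀ t ∈ s, ‖γ n t‖ ≤ 2 * |t|) ∧ (∀ t ∈ s, γ n t ∈ Metric.ball 0 r) ∧
      (∀ t ∈ s, ‖fderiv ℝ G (γ n t)‖ ≤ μ + 2 * C * ρ) := by
    rintro n ⟨h1, h2, h3, h4⟩
    have a1 : ∀ t ∈ s, ‖γ' n t‖ ≤ 2 := fun t ht => by
      have := h4 t ht 0 h0s
      rw [h3, sub_zero] at this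
      have ht' : |t| < ρ := by simpa [hs] using ht
      have : ‖γ' n t‖ ≤ ‖e'‖ + ‖γ' n t - e'‖ := by
        simpa using norm_add_le e' (γ' n t - e')
      have hh : ‖e'‖ = 1 := by rw [he', ContinuousLinearMap.norm_toSpanSingleton, he1]
      nlinarith
    have a2 : ∀ t ∈ s, ∀ u ∈ s, ‖γ n t - γ n u‖ ≤ 2 * |t - u| := fun t ht u hu =>
      (convex_ball (0 : ℝ) ρ).norm_image_sub_le_of_norm_hasFDerivWithin_le
        (fun x hx => (h1 x hx).hasFDerivWithinAt) a1 hu ht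
    have a3 : ∀ t ∈ s, ‖γ n t‖ ≤ 2 * |t| := fun t ht => by
      simpa [h2] using a2 t ht 0 h0s
    have a4 : ∀ t ∈ s, γ n t ∈ Metric.ball 0 r := fun t ht => by
      have ht' : |t| < ρ := by simpa [hs] using ht
      rw [mem_ball_zero_iff]
      linarith [a3 t ht]
    refine ⟨a1, a2, a3, a4, fun t ht => ?_⟩
    have ht' : |t| < ρ := by simpa [hs] using ht
    have b1 := hlip _ (a4 t ht) 0 (by simpa using hr)
    have b2 : ‖fderiv ℝ G (γ n t)‖ ≤ ‖fderiv ℝ G 0‖ + ‖fderiv ℝ G (γ n t) - fderiv ℝ G 0‖ := by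
      simpa using norm_add_le (fderiv ℝ G 0) (fderiv ℝ G (γ n t) - fderiv ℝ G 0)
    rw [sub_zero] at b1
    nlinarith [a3 t ht]
  have hind : ∀ n, (∀ t ∈ s, HasFDerivAt (γ n) (γ' n t) t) ∧ γ n 0 = 0 ∧ γ' n 0 = e' ∧
      (∀ t ∈ s, ∀ u ∈ s, ‖γ' n t - γ' n u‖ ≤ K * |t - u|) := by
    intro n
    induction n with
    | zero =>
      refine ⟨fun t _ => ?_, by simp [hγ, unstableCurveSeq], rfl, fun t _ u _ => ?_⟩
      · exact e'.hasFDerivAt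
      · have : γ' 0 t - γ' 0 u = 0 := sub_self _
        rw [this, norm_zero]
        positivity
    | succ n ih =>
      obtain ⟨a1, a2, a3, a4, a5⟩ := hbnd n ih
      obtain ⟨h1, h2, h3, h4⟩ := ih
      refine ⟨fun t ht => ?_, by rw [hγs, mul_zero, h2, hG0], ?_, fun t ht u hu => ?_⟩
      · have hin : HasFDerivAt (fun t : ℝ => l * t) (l • ContinuousLinearMap.id ℝ ℝ) t :=
          (hasFDerivAt_id t).const_smul l
        have := ((hdiff _ (a4 _ (hls t ht))).hasFDerivAt.comp (l * t) (h1 _ (hls t ht))).comp t hin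
        rw [hγs']
        refine (this.congr_fderiv ?_).congr_of_eventuallyEq
          (Eventually.of_forall fun t => hγs n t)
        ext
        simp
      · rw [hγs', mul_zero, h2, h3]
        ext
        simp [he', he, smul_smul, hlμ]
      · rw [hγs', hγs', hsm]
        have ht' := hls t ht
        have hu' := hls u hu
        have b := norm_comp_sub_comp_le (fderiv ℝ G (γ n (l * t))) (fderiv ℝ G (γ n (l * u)))
          (γ' n (l * t)) (γ' n (l * u))
        have b1 := hlip _ (a4 _ ht') _ (a4 _ hu')
        have b2 := a2 _ ht' _ hu'
        have b3 := h4 _ ht' _ hu'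
        have hlt : |l * t - l * u| = l * |t - u| := by
          rw [← mul_sub, abs_mul, abs_of_pos hl0]
        rw [hlt] at b2 b3
        have h0 : 0 ≤ |t - u| := abs_nonneg _
        calc l * _ ≤ l * (C * (2 * (l * |t - u|)) * 2 + (μ + 2 * C * ρ) * (K * (l * |t - u|))) := by
              gcongr
              refine b.trans ?_
              gcongr
              · exact b1.trans (by gcongr)
              · exact a1 _ ht'
              · exact a5 _ hu'
          _ = (l ^ 2 * (4 * C) + l * μ * (l * K) + l ^ 2 * (2 * C * (K * ρ))) * |t - u| := by ring
          _ ≤ (1 * (4 * C) + 1 * (l * K) + 1 * (2 * C * 1)) * |t - u| := by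
              gcongr
              · exact pow_le_one₀ hl0.le hl1.le
              · exact hlμ.le
              · exact pow_le_one₀ hl0.le hl1.le
          _ = K * |t - u| := by linear_combination |t - u| * hKC
  obtain ⟨θ, hθdef⟩ : ∃ θ, θ = (1 + l) / 2 := ⟨_, rfl⟩
  have hθ0 : 0 < θ := by linarith
  have hθ1 : θ < 1 := by linarith
  have hconv : ∀ n, ∀ t ∈ s, ‖γ' (n + 1) t - γ' n t‖ ≤ 2 * K * θ ^ n * |t| := by
    intro n
    induction n with
    | zero =>
      intro t ht
      have c1 := (hind 1).2.2.2 t ht 0 h0s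
      have c2 := (hind 0).2.2.2 t ht 0 h0s
      rw [(hind 1).2.2.1] at c1
      rw [(hind 0).2.2.1] at c2
      have : γ' (0 + 1) t - γ' 0 t = (γ' 1 t - e') - (γ' 0 t - e') := by simp
      rw [this]
      refine (norm_sub_le _ _).trans ?_
      simp only [sub_zero, pow_zero] at c1 c2 ⊢
      linarith
    | succ n ih =>
      intro t ht
      have ht' := hls t ht
      obtain ⟨a1, a2, a3, a4, a5⟩ := hbnd n (hind n)
      obtain ⟨a1', a2', a3', a4', a5'⟩ := hbnd (n + 1) (hind (n + 1))
      have htρ : |t| < ρ := by simpa [hs] using ht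
      have hsub : ∀ x ∈ Metric.closedBall (0 : ℝ) |l * t|, x ∈ s := fun x hx => by
        have h1 : |x| ≤ |l * t| := by simpa using hx
        have h2 : |l * t| < ρ := by simpa [hs] using ht'
        simpa [hs] using h1.trans_lt h2
      have d1 : ‖γ (n + 1) (l * t) - γ n (l * t)‖ ≤ 2 * K * θ ^ n * |l * t| * |l * t| := by
        have := (convex_closedBall (0 : ℝ) |l * t|).norm_image_sub_le_of_norm_hasFDerivWithin_le
          (f := fun x => γ (n + 1) x - γ n x) (C := 2 * K * θ ^ n * |l * t|)
          (fun x hx => (((hind (n + 1)).1 x (hsub x hx)).sub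
            ((hind n).1 x (hsub x hx))).hasFDerivWithinAt)
          (fun x hx => (ih x (hsub x hx)).trans (by
            have h1 : |x| ≤ |l * t| := by simpa using hx
            gcongr)) (x := 0) (y := l * t)
          (Metric.mem_closedBall_self (abs_nonneg _)) (by simp)
        simpa [(hind (n + 1)).2.1, (hind n).2.1] using this
      have d2 := ih _ ht'
      have hlt : |l * t| = l * |t| := by rw [abs_mul, abs_of_pos hl0]
      rw [hlt] at d1 d2
      rw [hγs' (n + 1) t, hγs' n t, hsm]
      have b := norm_comp_sub_comp_le (fderiv ℝ G (γ (n + 1) (l * t))) (fderiv ℝ G (γ n (l * t)))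
          (γ' (n + 1) (l * t)) (γ' n (l * t))
      have b1 := hlip _ (a4' _ ht') _ (a4 _ ht')
      have h0 : 0 ≤ |t| := abs_nonneg _
      calc l * _ ≤ l * (C * (2 * K * θ ^ n * (l * |t|) * (l * |t|)) * 2 +
              (μ + 2 * C * ρ) * (2 * K * θ ^ n * (l * |t|))) := by
            gcongr
            refine b.trans ?_
            gcongr
            · exact b1.trans (by gcongr)
            · exact a1' _ ht'
            · exact a5 _ ht'
        _ = (2 * K * θ ^ n * |t|) *
            (l ^ 3 * (2 * C * |t|) + (l * μ) * l + l ^ 2 * (2 * C * ρ)) := by ring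
        _ ≤ (2 * K * θ ^ n * |t|) * (1 * (2 * C * ρ) + 1 * l + 1 * (2 * C * ρ)) := by
            gcongr
            · exact pow_le_one₀ hl0.le hl1.le
            · exact hlμ.le
            · exact pow_le_one₀ hl0.le hl1.le
        _ ≤ (2 * K * θ ^ n * |t|) * θ := by
            gcongr
            linarith
        _ = 2 * K * θ ^ (n + 1) * |t| := by ring
  obtain ⟨g, g', hg⟩ := exists_limit_hasFDerivAt Metric.isOpen_ball
    (convex_ball (0 : ℝ) ρ).isPreconnected (fun n => (hind n).1) hθ0.le hθ1
    (D := 2 * K * ρ) (fun n t ht => (hconv n t ht).trans (by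
      have htρ : |t| < ρ := by simpa [hs] using ht
      rw [mul_right_comm]
      gcongr)) h0s
    (fun n => by rw [(hind n).2.1, (hind 0).2.1])
  have hsn : s ∈ 𝓝 (0 : ℝ) := Metric.ball_mem_nhds _ hρ
  have hglip : ∀ t ∈ s, ∀ u ∈ s, ‖g' t - g' u‖ ≤ K * |t - u| := fun t ht u hu =>
    le_of_tendsto (((hg t ht).2.2.sub (hg u hu).2.2).norm)
      (Eventually.of_forall fun n => (hind n).2.2.2 t ht u hu)
  have hg0 : g 0 = 0 := tendsto_nhds_unique (hg 0 h0s).2.1 (by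
    simp only [(hind _).2.1]
    exact tendsto_const_nhds)
  have hg0' : g' 0 = e' := tendsto_nhds_unique (hg 0 h0s).2.2 (by
    simp only [(hind _).2.2.1]
    exact tendsto_const_nhds)
  refine ⟨g, HolderDiffAt.of_eventually (f' := g') (K := K) ?_ ?_, hg0, ?_, ?_⟩
  · filter_upwards [hsn] with t ht using (hg t ht).1
  · rw [nhds_prod_eq]
    filter_upwards [prod_mem_prod hsn hsn] with z hz
    simpa using hglip z.1 hz.1 z.2 hz.2
  · rw [← hg0']
    exact (hg 0 h0s).1
  · have hcont : Tendsto (fun t : ℝ => μ * t) (𝓝 0) (𝓝 0) :=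
      (continuous_const.mul continuous_id).tendsto' _ _ (by simp)
    filter_upwards [hsn, hcont.eventually hsn] with t ht ht'
    have hgt : ‖g t‖ ≤ 2 * |t| := le_of_tendsto (hg t ht).2.1.norm
      (Eventually.of_forall fun n => (hbnd n (hind n)).2.2.1 t ht)
    have htρ : |t| < ρ := by simpa [hs] using ht
    have hgr : g t ∈ Metric.ball 0 r := by
      rw [mem_ball_zero_iff]
      linarith
    have t1 := (hdiff _ hgr).continuousAt.tendsto.comp (hg t ht).2.1
    have t2 := ((hg _ ht').2.1).comp (tendsto_add_atTop_nat 1)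
    refine tendsto_nhds_unique t1 (t2.congr fun n => ?_)
    simp only [Function.comp]
    rw [hγs, ← mul_assoc, hlμ, one_mul]

end Curve

theorem sum_min_pow_mul_le {μ l : ℝ} (hμ : 1 < μ) (hlμ : l * μ = 1) (n : ℕ) {a : ℝ}
    (ha : 0 ≤ a) :
    ∑ i ∈ Finset.range n, min (μ ^ i * a) (l ^ i) ≤ 2 / (1 - l) * √a := by
  have hl : l = μ⁻¹ := eq_inv_of_mul_eq_one_left hlμ
  have hμ0 : 0 < μ := by linarith
  have hl0 : 0 < l := hl ▸ inv_pos.2 hμ0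
  have hl1 : l < 1 := hl ▸ inv_lt_one_of_one_lt₀ hμ
  have h1l : 0 < 1 - l := by linarith
  obtain ⟨B, hBdef⟩ : ∃ B, B = 1 / (1 - l) := ⟨_, rfl⟩
  have hB : B * (1 - l) = 1 := by rw [hBdef]; field_simp
  have hB0 : 0 < B := by rw [hBdef]; positivity
  have key : ∀ n : ℕ, ∀ s : ℝ, 0 ≤ s →
      (s ≤ 1 → ∑ i ∈ Finset.range n, min (μ ^ i * s ^ 2) (l ^ i) ≤ B * (2 * s - s ^ 2)) ∧
      ∑ i ∈ Finset.range n, min (μ ^ i * s ^ 2) (l ^ i) ≤ B := by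
    intro n
    induction n with
    | zero =>
      intro s hs
      refine ⟨fun h => ?_, by simpa using hB0.le⟩
      simp only [Finset.range_zero, Finset.sum_empty]
      exact mul_nonneg hB0.le (by nlinarith)
    | succ n ih =>
      intro s hs
      obtain ⟨ih1, ih2⟩ := ih (μ * s) (by positivity)
      have hsum : ∑ i ∈ Finset.range (n + 1), min (μ ^ i * s ^ 2) (l ^ i) =
          l * ∑ i ∈ Finset.range n, min (μ ^ i * (μ * s) ^ 2) (l ^ i) + min (s ^ 2) 1 := by
        rw [Finset.sum_range_succ', Finset.mul_sum]
        simp only [pow_zero, one_mul]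
        congr 1
        refine Finset.sum_congr rfl fun i _ => ?_
        rw [mul_min_of_nonneg _ _ hl0.le]
        congr 1
        · linear_combination (-(μ ^ (i + 1) * s ^ 2)) * hlμ
        · ring
      rw [hsum]
      have hm1 := min_le_left (s ^ 2) 1
      have hm2 := min_le_right (s ^ 2) 1
      refine ⟨fun h => ?_, by nlinarith⟩
      rcases le_or_gt (μ * s) 1 with h1 | h1
      · have h2 := mul_le_mul_of_nonneg_left (ih1 h1) hl0.le
        have h3 : l * (B * (2 * (μ * s) - (μ * s) ^ 2)) = B * (2 * s - μ * s ^ 2) := by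
          linear_combination (2 * B * s - B * μ * s ^ 2) * hlμ
        have h4 : B * (μ - 1) = μ := by linear_combination μ * hB + B * hlμ
        nlinarith [sq_nonneg s]
      · have h2 := mul_le_mul_of_nonneg_left ih2 hl0.le
        have h3 : l < s := by
          have : l * 1 < l * (μ * s) := by gcongr
          rwa [mul_one, ← mul_assoc, hlμ, one_mul] at this
        have h5 : 0 ≤ (s - l) * (1 - s) := mul_nonneg (by linarith) (by linarith)
        have h6 : 0 ≤ B * ((s - l) * (1 - s)) := by positivity
        nlinarith
  have h1 := key n (√a) (Real.sqrt_nonneg a)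
  rw [Real.sq_sqrt ha] at h1
  have h2 : 2 / (1 - l) * √a = B * (2 * √a) := by rw [hBdef]; ring
  rw [h2]
  rcases le_or_gt (√a) 1 with h | h
  · refine (h1.1 h).trans ?_
    gcongr
    linarith
  · refine h1.2.trans ?_
    nlinarith

/-- The linear map `(x, y) ↦ (a x, b y)`. -/
def diagCLM (a b : ℝ) : ℝ × ℝ →L[ℝ] ℝ × ℝ :=
  (a • ContinuousLinearMap.fst ℝ ℝ ℝ).prod (b • ContinuousLinearMap.snd ℝ ℝ ℝ)

@[simp] theorem diagCLM_apply (a b : ℝ) (p : ℝ × ℝ) : diagCLM a b p = (a * p.1, b * p.2) := rfl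

/-- A `C^{1,1}`-small perturbation of the saddle `(x, y) ↦ (μ x, μ⁻¹ y)` which vanishes on both
axes and whose derivative vanishes for `1 ≤ |x|`. -/
structure IsSaddlePerturbation (μ l C ε : ℝ) (F : ℝ × ℝ → ℝ × ℝ) : Prop where
  one_lt : 1 < μ
  mul_eq : l * μ = 1
  C_nonneg : 0 ≤ C
  eps_nonneg : 0 ≤ ε
  eps_le : ε ≤ (1 - l) / 2
  differentiable : Differentiable ℝ F
  lipschitz : ∀ p q, ‖fderiv ℝ F p - fderiv ℝ F q‖ ≤ C * ‖p - q‖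
  norm_fderiv_le : ∀ p, ‖fderiv ℝ F p‖ ≤ ε
  fderiv_eq_zero : ∀ p : ℝ × ℝ, 1 ≤ |p.1| → fderiv ℝ F p = 0
  fst_axis : ∀ x, F (x, 0) = 0
  snd_axis : ∀ y, F (0, y) = 0

namespace IsSaddlePerturbation

variable {μ l C ε : ℝ} {F : ℝ × ℝ → ℝ × ℝ}

theorem l_pos (h : IsSaddlePerturbation μ l C ε F) : 0 < l := by
  have := h.mul_eq
  have := h.one_lt
  by_contra hl
  nlinarith

theorem l_lt_one (h : IsSaddlePerturbation μ l C ε F) : l < 1 := by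
  have := h.mul_eq
  have := h.one_lt
  have := h.l_pos
  by_contra hl
  nlinarith

theorem fderiv_fst_axis (h : IsSaddlePerturbation μ l C ε F) (x : ℝ) :
    fderiv ℝ F (x, 0) (1, 0) = 0 := by
  have h1 : HasDerivAt (fun x : ℝ => (x, (0 : ℝ))) (1, 0) x :=
    (hasDerivAt_id x).prodMk (hasDerivAt_const x 0)
  have h2 := (h.differentiable (x, 0)).hasFDerivAt.comp_hasDerivAt x h1
  have h3 : F ∘ (fun x : ℝ => (x, (0 : ℝ))) = fun _ => 0 := funext h.fst_axis
  rw [h3] at h2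
  exact h2.unique (hasDerivAt_const x 0)

theorem fderiv_snd_axis (h : IsSaddlePerturbation μ l C ε F) (y : ℝ) :
    fderiv ℝ F (0, y) (0, 1) = 0 := by
  have h1 : HasDerivAt (fun y : ℝ => ((0 : ℝ), y)) (0, 1) y :=
    (hasDerivAt_const y 0).prodMk (hasDerivAt_id y)
  have h2 := (h.differentiable (0, y)).hasFDerivAt.comp_hasDerivAt y h1
  have h3 : F ∘ (fun y : ℝ => ((0 : ℝ), y)) = fun _ => 0 := funext h.snd_axis
  rw [h3] at h2
  exact h2.unique (hasDerivAt_const y 0)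

theorem norm_fderiv_fst_le (h : IsSaddlePerturbation μ l C ε F) (p : ℝ × ℝ) :
    ‖fderiv ℝ F p (1, 0)‖ ≤ C * |p.2| := by
  have h1 := (fderiv ℝ F p - fderiv ℝ F (p.1, 0)).le_opNorm (1, 0)
  have h2 := h.lipschitz p (p.1, 0)
  have h3 : ‖p - (p.1, 0)‖ = |p.2| := by simp [Prod.norm_def]
  have h4 : ‖((1 : ℝ), (0 : ℝ))‖ = 1 := by simp [Prod.norm_def]
  rw [h3] at h2
  rw [h4, mul_one, sub_apply, h.fderiv_fst_axis, sub_zero] at h1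
  exact h1.trans h2

theorem norm_fderiv_snd_le (h : IsSaddlePerturbation μ l C ε F) (p : ℝ × ℝ) :
    ‖fderiv ℝ F p (0, 1)‖ ≤ C * |p.1| := by
  have h1 := (fderiv ℝ F p - fderiv ℝ F (0, p.2)).le_opNorm (0, 1)
  have h2 := h.lipschitz p (0, p.2)
  have h3 : ‖p - (0, p.2)‖ = |p.1| := by simp [Prod.norm_def]
  have h4 : ‖((0 : ℝ), (1 : ℝ))‖ = 1 := by simp [Prod.norm_def]
  rw [h3] at h2
  rw [h4, mul_one, sub_apply, h.fderiv_snd_axis, sub_zero] at h1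
  exact h1.trans h2

theorem norm_le_of_fderiv_snd_le (h : IsSaddlePerturbation μ l C ε F) (p : ℝ × ℝ) {b : ℝ}
    (hb : ∀ s, ‖fderiv ℝ F (p.1, s) (0, 1)‖ ≤ b) : ‖F p‖ ≤ b * |p.2| := by
  have h1 : ∀ s : ℝ, HasDerivAt (fun s : ℝ => F (p.1, s)) (fderiv ℝ F (p.1, s) (0, 1)) s :=
    fun s => (h.differentiable (p.1, s)).hasFDerivAt.comp_hasDerivAt s
      ((hasDerivAt_const s p.1).prodMk (hasDerivAt_id s))
  have h2 := convex_univ.norm_image_sub_le_of_norm_hasDerivWithin_le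
    (fun s _ => (h1 s).hasDerivWithinAt) (fun s _ => hb s) (Set.mem_univ 0) (Set.mem_univ p.2)
  simpa [h.fst_axis] using h2

theorem norm_le_of_fderiv_fst_le (h : IsSaddlePerturbation μ l C ε F) (p : ℝ × ℝ) {b : ℝ}
    (hb : ∀ s, ‖fderiv ℝ F (s, p.2) (1, 0)‖ ≤ b) : ‖F p‖ ≤ b * |p.1| := by
  have h1 : ∀ s : ℝ, HasDerivAt (fun s : ℝ => F (s, p.2)) (fderiv ℝ F (s, p.2) (1, 0)) s :=
    fun s => (h.differentiable (s, p.2)).hasFDerivAt.comp_hasDerivAt s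
      ((hasDerivAt_id s).prodMk (hasDerivAt_const s p.2))
  have h2 := convex_univ.norm_image_sub_le_of_norm_hasDerivWithin_le
    (fun s _ => (h1 s).hasDerivWithinAt) (fun s _ => hb s) (Set.mem_univ 0) (Set.mem_univ p.1)
  simpa [h.snd_axis] using h2

theorem norm_fderiv_apply_le (h : IsSaddlePerturbation μ l C ε F) (p v : ℝ × ℝ) :
    ‖fderiv ℝ F p v‖ ≤ ε * ‖v‖ :=
  (fderiv ℝ F p).le_of_opNorm_le (h.norm_fderiv_le p) v

theorem norm_le_mul_snd (h : IsSaddlePerturbation μ l C ε F) (p : ℝ × ℝ) :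
    ‖F p‖ ≤ C * |p.1| * |p.2| :=
  h.norm_le_of_fderiv_snd_le p fun s => h.norm_fderiv_snd_le (p.1, s)

theorem norm_le_eps_snd (h : IsSaddlePerturbation μ l C ε F) (p : ℝ × ℝ) :
    ‖F p‖ ≤ ε * |p.2| :=
  h.norm_le_of_fderiv_snd_le p fun s => by
    simpa [Prod.norm_def] using h.norm_fderiv_apply_le (p.1, s) (0, 1)

theorem norm_le_eps_fst (h : IsSaddlePerturbation μ l C ε F) (p : ℝ × ℝ) :
    ‖F p‖ ≤ ε * |p.1| :=
  h.norm_le_of_fderiv_fst_le p fun s => by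
    simpa [Prod.norm_def] using h.norm_fderiv_apply_le (s, p.2) (1, 0)

theorem eq_zero_of_one_le (h : IsSaddlePerturbation μ l C ε F) {p : ℝ × ℝ} (hp : 1 ≤ |p.1|) :
    F p = 0 := by
  have := h.norm_le_of_fderiv_snd_le p (b := 0) fun s => by
    rw [h.fderiv_eq_zero (p.1, s) hp]
    simp
  simpa using this

/-- The perturbed saddle map. -/
def map (_ : IsSaddlePerturbation μ l C ε F) (p : ℝ × ℝ) : ℝ × ℝ := diagCLM μ l p + F p

/-- The constant controlling the contraction of the second coordinate along orbits. -/
def rate (_ : IsSaddlePerturbation μ l C ε F) : ℝ := μ * C / ((1 - l) / 2)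

theorem rate_nonneg (h : IsSaddlePerturbation μ l C ε F) : 0 ≤ h.rate := by
  have := h.C_nonneg
  have := h.one_lt
  have : 0 < 1 - l := by linarith [h.l_lt_one]
  unfold rate
  positivity

theorem abs_snd_map_le (h : IsSaddlePerturbation μ l C ε F) (p : ℝ × ℝ) :
    |(h.map p).2| ≤ l * |p.2| * Real.exp (h.rate * (|(h.map p).1| - |p.1|)) := by
  have hl := h.l_pos
  have hl1 := h.l_lt_one
  have hμ := h.one_lt
  have hmul := h.mul_eq
  have hC := h.C_nonneg
  have h1 : (h.map p).1 = μ * p.1 + (F p).1 := rfl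
  have h2 : (h.map p).2 = l * p.2 + (F p).2 := rfl
  rcases le_or_gt 1 |p.1| with hp | hp
  · rw [h1, h2, h.eq_zero_of_one_le hp]
    simp only [Prod.fst_zero, Prod.snd_zero, add_zero, abs_mul, abs_of_pos hl]
    refine le_mul_of_one_le_right (by positivity) (Real.one_le_exp ?_)
    refine mul_nonneg h.rate_nonneg ?_
    rw [abs_of_pos (by linarith)]
    nlinarith [abs_nonneg p.1]
  · have h3 : |(h.map p).2| ≤ l * |p.2| * (1 + μ * C * |p.1|) := by
      rw [h2]
      refine (abs_add_le _ _).trans ?_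
      rw [abs_mul, abs_of_pos hl]
      have h5 := (norm_snd_le (F p)).trans (h.norm_le_mul_snd p)
      rw [Real.norm_eq_abs] at h5
      have h6 : l * |p.2| * (1 + μ * C * |p.1|) = l * |p.2| + C * |p.1| * |p.2| := by
        linear_combination (C * |p.1| * |p.2|) * hmul
      rw [h6]
      gcongr
    have h4 : μ * C * |p.1| ≤ h.rate * (|(h.map p).1| - |p.1|) := by
      have h5 := (norm_fst_le (F p)).trans (h.norm_le_eps_fst p)
      rw [Real.norm_eq_abs] at h5
      have h6 : μ * |p.1| - |(F p).1| ≤ |(h.map p).1| := by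
        have := abs_sub_abs_le_abs_add (μ * p.1) (F p).1
        rwa [abs_mul, abs_of_pos (by linarith : 0 < μ)] at this
      have h7 : (1 - l) / 2 * |p.1| ≤ |(h.map p).1| - |p.1| := by
        have : 1 - l ≤ μ - 1 := by nlinarith
        have := h.eps_le
        nlinarith [abs_nonneg p.1]
      have h8 : h.rate * ((1 - l) / 2 * |p.1|) = μ * C * |p.1| := by
        unfold rate
        have : 1 - l ≠ 0 := by linarith
        field_simp
      rw [← h8]
      exact mul_le_mul_of_nonneg_left h7 h.rate_nonneg
    refine h3.trans ?_
    gcongr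
    linarith [Real.add_one_le_exp (h.rate * (|(h.map p).1| - |p.1|))]

theorem abs_snd_map_le_self (h : IsSaddlePerturbation μ l C ε F) (p : ℝ × ℝ) :
    |(h.map p).2| ≤ |p.2| := by
  have hl := h.l_pos
  have h2 : (h.map p).2 = l * p.2 + (F p).2 := rfl
  have h5 := (norm_snd_le (F p)).trans (h.norm_le_eps_snd p)
  rw [Real.norm_eq_abs] at h5
  have := abs_add_le (l * p.2) (F p).2
  rw [abs_mul, abs_of_pos hl, ← h2] at this
  nlinarith [h.eps_le, h.l_lt_one, abs_nonneg p.2]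

theorem abs_snd_iterate_le (h : IsSaddlePerturbation μ l C ε F) (n : ℕ) (p : ℝ × ℝ) :
    |(h.map^[n] p).2| ≤ l ^ n * |p.2| * Real.exp (h.rate * (|(h.map^[n] p).1| - |p.1|)) := by
  have hl := h.l_pos
  induction n with
  | zero => simp
  | succ n ih =>
    rw [Function.iterate_succ_apply']
    refine (h.abs_snd_map_le _).trans ?_
    calc _ ≤ l * (l ^ n * |p.2| * Real.exp (h.rate * (|(h.map^[n] p).1| - |p.1|))) *
          Real.exp (h.rate * (|(h.map (h.map^[n] p)).1| - |(h.map^[n] p).1|)) := by gcongr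
      _ = l ^ (n + 1) * |p.2| * (Real.exp (h.rate * (|(h.map^[n] p).1| - |p.1|)) *
          Real.exp (h.rate * (|(h.map (h.map^[n] p)).1| - |(h.map^[n] p).1|))) := by ring
      _ = _ := by
        rw [← Real.exp_add]
        congr 2
        ring

/-- The horizontal strip on which the linearizing coordinate is constructed. -/
def strip : Set (ℝ × ℝ) := {p | |p.2| < 1}

theorem isOpen_strip : IsOpen strip := isOpen_lt (by fun_prop) (by fun_prop)

theorem convex_strip : Convex ℝ strip := by
  have : strip = (LinearMap.snd ℝ ℝ ℝ) ⁻¹' Metric.ball 0 1 := by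
    ext p
    simp [strip]
  rw [this]
  exact (convex_ball 0 1).linear_preimage _

theorem map_mem_strip (h : IsSaddlePerturbation μ l C ε F) {p : ℝ × ℝ} (hp : p ∈ strip) :
    h.map p ∈ strip :=
  (h.abs_snd_map_le_self p).trans_lt hp

theorem iterate_mem_strip (h : IsSaddlePerturbation μ l C ε F) {p : ℝ × ℝ} (hp : p ∈ strip)
    (n : ℕ) : h.map^[n] p ∈ strip := by
  induction n with
  | zero => exact hp
  | succ n ih =>
    rw [Function.iterate_succ_apply']
    exact h.map_mem_strip ih

theorem norm_fderiv_fst_iterate_le (h : IsSaddlePerturbation μ l C ε F) {p : ℝ × ℝ}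
    (hp : p ∈ strip) (n : ℕ) :
    ‖fderiv ℝ F (h.map^[n] p) (1, 0)‖ ≤ C * Real.exp h.rate * l ^ n := by
  have hl := h.l_pos
  have hC := h.C_nonneg
  rcases le_or_gt 1 |(h.map^[n] p).1| with h1 | h1
  · rw [h.fderiv_eq_zero _ h1]
    simp only [zero_apply, norm_zero]
    positivity
  · have h2 := h.abs_snd_iterate_le n p
    have hp' : |p.2| ≤ 1 := le_of_lt hp
    have h3 : Real.exp (h.rate * (|(h.map^[n] p).1| - |p.1|)) ≤ Real.exp h.rate := by
      rw [Real.exp_le_exp]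
      nlinarith [h.rate_nonneg, abs_nonneg p.1]
    calc _ ≤ C * |(h.map^[n] p).2| := h.norm_fderiv_fst_le _
      _ ≤ C * (l ^ n * 1 * Real.exp h.rate) := by
        gcongr
        refine h2.trans ?_
        gcongr
      _ = _ := by ring

theorem hasFDerivAt_map (h : IsSaddlePerturbation μ l C ε F) (p : ℝ × ℝ) :
    HasFDerivAt h.map (diagCLM μ l + fderiv ℝ F p) p :=
  (diagCLM μ l).hasFDerivAt.add (h.differentiable p).hasFDerivAt

theorem differentiable_map (h : IsSaddlePerturbation μ l C ε F) : Differentiable ℝ h.map :=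
  fun p => (h.hasFDerivAt_map p).differentiableAt

theorem fderiv_iterate_succ (h : IsSaddlePerturbation μ l C ε F) (n : ℕ) (p : ℝ × ℝ) :
    fderiv ℝ h.map^[n + 1] p =
      (fderiv ℝ h.map^[n] (h.map p)).comp (diagCLM μ l + fderiv ℝ F p) := by
  rw [Function.iterate_succ, fderiv_comp p (h.differentiable_map.iterate n _)
    (h.differentiable_map p), (h.hasFDerivAt_map p).fderiv]

theorem fderiv_iterate_succ' (h : IsSaddlePerturbation μ l C ε F) (n : ℕ) (p : ℝ × ℝ) :
    fderiv ℝ h.map^[n + 1] p =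
      (diagCLM μ l + fderiv ℝ F (h.map^[n] p)).comp (fderiv ℝ h.map^[n] p) := by
  rw [Function.iterate_succ', fderiv_comp p (h.differentiable_map _)
    (h.differentiable_map.iterate n p), (h.hasFDerivAt_map _).fderiv]

theorem norm_apply_le (A : ℝ × ℝ →L[ℝ] ℝ × ℝ) (z : ℝ × ℝ) :
    ‖A z‖ ≤ ‖A (1, 0)‖ * |z.1| + ‖A‖ * |z.2| := by
  have h1 : A z = z.1 • A (1, 0) + z.2 • A (0, 1) := by
    rw [← map_smul, ← map_smul, ← map_add]
    simp
  have h2 : ‖A (0, 1)‖ ≤ ‖A‖ := by simpa [Prod.norm_def] using A.le_opNorm (0, 1)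
  rw [h1]
  refine (norm_add_le _ _).trans ?_
  rw [norm_smul, norm_smul, Real.norm_eq_abs, Real.norm_eq_abs, mul_comm |z.1|, mul_comm |z.2|]
  gcongr

/-- Along orbits in the strip the first component of the derivative cocycle grows at most like
`μ ^ n`, the second one stays bounded. -/
theorem exists_fderiv_iterate_le (h : IsSaddlePerturbation μ l C ε F) :
    ∃ A, 1 ≤ A ∧ ∀ p ∈ strip, ∀ n v, |(fderiv ℝ h.map^[n] p v).1| ≤ A * μ ^ n * ‖v‖ ∧
      |(fderiv ℝ h.map^[n] p v).2| ≤ A * ‖v‖ := by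
  have hl := h.l_pos
  have hl1 := h.l_lt_one
  have h1l : 0 < 1 - l := by linarith
  have hC := h.C_nonneg
  have hμ := h.one_lt
  have hlμ := h.mul_eq
  obtain ⟨C₀, hC₀⟩ : ∃ C₀, C₀ = C * Real.exp h.rate := ⟨_, rfl⟩
  have hC₀' : 0 ≤ C₀ := by rw [hC₀]; positivity
  obtain ⟨N, hN⟩ : ∃ N, N = 1 + C₀ / ((1 - l) / 2) := ⟨_, rfl⟩
  have hN1 : 1 ≤ N := by rw [hN]; linarith [show 0 ≤ C₀ / ((1 - l) / 2) by positivity]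
  have hNC : C₀ ≤ (1 - l) / 2 * N := by
    have : (1 - l) / 2 * N = (1 - l) / 2 + C₀ := by rw [hN]; field_simp
    linarith
  set S : ℕ → ℝ := fun n => Real.exp ((C₀ + N) * ∑ i ∈ Finset.range n, l ^ i) with hS
  have hSsucc : ∀ n, S n * (1 + (C₀ + N) * l ^ n) ≤ S (n + 1) := fun n => by
    simp only [hS, Finset.sum_range_succ, mul_add (C₀ + N), Real.exp_add]
    gcongr
    linarith [Real.add_one_le_exp ((C₀ + N) * l ^ n)]
  have hS0 : ∀ n, 0 < S n := fun n => Real.exp_pos _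
  have hSmono : ∀ n, S n ≤ S (n + 1) := fun n =>
    le_trans (le_mul_of_one_le_right (hS0 n).le (by
      have : 0 ≤ (C₀ + N) * l ^ n := by positivity
      linarith)) (hSsucc n)
  have key : ∀ p ∈ strip, ∀ n v, |(fderiv ℝ h.map^[n] p v).1| ≤ S n * μ ^ n * ‖v‖ ∧
      |(fderiv ℝ h.map^[n] p v).2| ≤ N * S n * ‖v‖ := by
    intro p hp n v
    induction n with
    | zero =>
      simp only [Function.iterate_zero, fderiv_id, ContinuousLinearMap.id_apply, hS,
        Finset.range_zero, Finset.sum_empty, mul_zero, Real.exp_zero, pow_zero, mul_one, one_mul]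
      refine ⟨norm_fst_le v, (norm_snd_le v).trans ?_⟩
      exact le_mul_of_one_le_left (norm_nonneg _) hN1
    | succ n ih =>
      obtain ⟨ih1, ih2⟩ := ih
      rw [h.fderiv_iterate_succ']
      set z := fderiv ℝ h.map^[n] p v with hz
      set w := fderiv ℝ F (h.map^[n] p) z with hw
      have e1 : (((diagCLM μ l + fderiv ℝ F (h.map^[n] p)).comp (fderiv ℝ h.map^[n] p)) v).1 =
        μ * z.1 + w.1 := rfl
      have e2 : (((diagCLM μ l + fderiv ℝ F (h.map^[n] p)).comp (fderiv ℝ h.map^[n] p)) v).2 =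
        l * z.2 + w.2 := rfl
      have hwn : ‖w‖ ≤ C₀ * l ^ n * |z.1| + (1 - l) / 2 * |z.2| := by
        refine (norm_apply_le _ z).trans ?_
        gcongr
        · rw [hC₀]
          exact h.norm_fderiv_fst_iterate_le hp n
        · exact (h.norm_fderiv_le _).trans h.eps_le
      have hln : l ^ n * μ ^ n = 1 := by rw [← mul_pow, hlμ, one_pow]
      have hv : 0 ≤ ‖v‖ := norm_nonneg v
      have hSn := hS0 n
      have hwn2 : ‖w‖ ≤ (C₀ + (1 - l) / 2 * N) * S n * ‖v‖ := by
        calc ‖w‖ ≤ C₀ * l ^ n * (S n * μ ^ n * ‖v‖) + (1 - l) / 2 * (N * S n * ‖v‖) :=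
              hwn.trans (by gcongr)
          _ = _ := by linear_combination C₀ * S n * ‖v‖ * hln
      have hμn : 1 ≤ μ ^ n := one_le_pow₀ hμ.le
      constructor
      · rw [e1]
        refine (abs_add_le _ _).trans ?_
        rw [abs_mul, abs_of_pos (by linarith : 0 < μ)]
        calc μ * |z.1| + |w.1| ≤ μ * (S n * μ ^ n * ‖v‖) +
              (C₀ + (1 - l) / 2 * N) * S n * ‖v‖ := by
              gcongr
              exact (norm_fst_le w).trans hwn2
          _ ≤ μ * (S n * μ ^ n * ‖v‖) + μ * (C₀ + N) * S n * ‖v‖ := by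
              gcongr
              nlinarith
          _ = S n * (1 + (C₀ + N) * l ^ n) * μ ^ (n + 1) * ‖v‖ := by
              linear_combination (-(μ * (C₀ + N) * S n * ‖v‖)) * hln
          _ ≤ S (n + 1) * μ ^ (n + 1) * ‖v‖ := by
              gcongr
              exact hSsucc n
      · rw [e2]
        refine (abs_add_le _ _).trans ?_
        rw [abs_mul, abs_of_pos hl]
        calc l * |z.2| + |w.2| ≤ l * (N * S n * ‖v‖) + (C₀ + (1 - l) / 2 * N) * S n * ‖v‖ := by
              gcongr
              exact (norm_snd_le w).trans hwn2
          _ ≤ l * (N * S n * ‖v‖) + ((1 - l) / 2 * N + (1 - l) / 2 * N) * S n * ‖v‖ := by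
              gcongr
          _ = N * S n * ‖v‖ := by ring
          _ ≤ N * S (n + 1) * ‖v‖ := by
              gcongr
              exact hSmono n
  obtain ⟨A, hA⟩ : ∃ A, A = Real.exp ((C₀ + N) * (1 - l)⁻¹) := ⟨_, rfl⟩
  have hSA : ∀ n, S n ≤ A := fun n => by
    rw [hA]
    simp only [hS]
    gcongr
    rw [← tsum_geometric_of_lt_one hl.le hl1]
    exact (summable_geometric_of_lt_one hl.le hl1).sum_le_tsum _ (fun i _ => by positivity)
  have hA1 : 1 ≤ A := by
    rw [hA]
    exact Real.one_le_exp (by positivity)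
  have hAN : A ≤ N * A := le_mul_of_one_le_left (by linarith) hN1
  refine ⟨N * A, by linarith, fun p hp n v => ?_⟩
  obtain ⟨k1, k2⟩ := key p hp n v
  have hμ0 : 0 < μ := by linarith
  refine ⟨k1.trans ?_, k2.trans ?_⟩
  · gcongr
    exact (hSA n).trans hAN
  · gcongr
    exact hSA n

theorem exists_linearizing_coordinate (h : IsSaddlePerturbation μ l C ε F) :
    ∃ (u : ℝ × ℝ → ℝ) (u' : ℝ × ℝ → ℝ × ℝ →L[ℝ] ℝ) (M : ℝ),
      (∀ p ∈ strip, HasFDerivAt u (u' p) p) ∧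
      (∀ p ∈ strip, ∀ q ∈ strip, ‖u' p - u' q‖ ≤ M * √‖p - q‖) ∧
      u 0 = 0 ∧ u' 0 = ContinuousLinearMap.fst ℝ ℝ ℝ ∧ ∀ p ∈ strip, u (h.map p) = μ * u p := by
  have hl := h.l_pos
  have hl1 := h.l_lt_one
  have h1l : 0 < 1 - l := by linarith
  have hC := h.C_nonneg
  have hμ := h.one_lt
  have hμ0 : 0 < μ := by linarith
  have hlμ := h.mul_eq
  have hln : ∀ n : ℕ, l ^ n * μ ^ n = 1 := fun n => by rw [← mul_pow, hlμ, one_pow]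
  obtain ⟨A, hA1, hA⟩ := h.exists_fderiv_iterate_le
  obtain ⟨C₀, hC₀⟩ : ∃ C₀, C₀ = C * Real.exp h.rate := ⟨_, rfl⟩
  have hC₀' : 0 ≤ C₀ := by rw [hC₀]; positivity
  have hFx : ∀ p ∈ strip, ∀ n, ‖fderiv ℝ F (h.map^[n] p) (1, 0)‖ ≤ C₀ * l ^ n := by
    rw [hC₀]
    exact fun p hp n => h.norm_fderiv_fst_iterate_le hp n
  have hε1 : ε ≤ 1 := by linarith [h.eps_le]
  have h0s : (0 : ℝ × ℝ) ∈ strip := by simp [strip]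
  have hM : ∀ p ∈ strip, ∀ n, ‖fderiv ℝ h.map^[n] p‖ ≤ A * μ ^ n := fun p hp n => by
    refine ContinuousLinearMap.opNorm_le_bound _ (by positivity) fun v => ?_
    obtain ⟨k1, k2⟩ := hA p hp n v
    refine max_le k1 (k2.trans ?_)
    gcongr
    exact le_mul_of_one_le_right (by linarith) (one_le_pow₀ hμ.le)
  have hdist : ∀ p ∈ strip, ∀ q ∈ strip, ∀ n,
      ‖h.map^[n] p - h.map^[n] q‖ ≤ A * μ ^ n * ‖p - q‖ := fun p hp q hq n =>
    convex_strip.norm_image_sub_le_of_norm_fderiv_le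
      (fun x _ => h.differentiable_map.iterate n x) (fun x hx => hM x hx n) hq hp
  set w : ℕ → ℝ × ℝ → ℝ × ℝ →L[ℝ] ℝ := fun n p =>
    l ^ n • (ContinuousLinearMap.fst ℝ ℝ ℝ).comp (fderiv ℝ h.map^[n] p) with hw
  have hwv : ∀ n p v, w n p v = l ^ n * (fderiv ℝ h.map^[n] p v).1 := fun n p v => rfl
  have hwA : ∀ p ∈ strip, ∀ n, ‖w n p‖ ≤ A := fun p hp n => by
    refine ContinuousLinearMap.opNorm_le_bound _ (by positivity) fun v => ?_
    rw [hwv, Real.norm_eq_abs, abs_mul, abs_of_pos (pow_pos hl n)]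
    calc _ ≤ l ^ n * (A * μ ^ n * ‖v‖) := by gcongr; exact (hA p hp n v).1
      _ = A * ‖v‖ := by linear_combination A * ‖v‖ * hln n
  set f : ℕ → ℝ × ℝ → ℝ := fun n p => l ^ n * (h.map^[n] p).1 with hf
  have hfw : ∀ n, ∀ p ∈ strip, HasFDerivAt (f n) (w n p) p := fun n p _ =>
    (((ContinuousLinearMap.fst ℝ ℝ ℝ).hasFDerivAt).comp p
      (h.differentiable_map.iterate n p).hasFDerivAt).const_smul (l ^ n)
  have hmap0 : h.map 0 = 0 := by
    have := h.fst_axis 0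
    rw [Prod.mk_zero_zero] at this
    simp [map, this]
  have hit0 : ∀ n, h.map^[n] 0 = 0 := fun n => Function.iterate_fixed hmap0 n
  have hf0 : ∀ n, f n 0 = 0 := fun n => by simp [hf, hit0]
  have hdiff : ∀ n, ∀ p ∈ strip, ‖w (n + 1) p - w n p‖ ≤ A * (C₀ + 1) * l ^ n := by
    intro n p hp
    refine ContinuousLinearMap.opNorm_le_bound _ (by positivity) fun v => ?_
    obtain ⟨k1, k2⟩ := hA p hp n v
    rw [sub_apply, hwv, hwv, h.fderiv_iterate_succ']
    set z := fderiv ℝ h.map^[n] p v with hz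
    have e1 : (((diagCLM μ l + fderiv ℝ F (h.map^[n] p)).comp (fderiv ℝ h.map^[n] p)) v).1 =
        μ * z.1 + (fderiv ℝ F (h.map^[n] p) z).1 := rfl
    have e2 : l ^ (n + 1) * (μ * z.1 + (fderiv ℝ F (h.map^[n] p) z).1) - l ^ n * z.1 =
        l ^ (n + 1) * (fderiv ℝ F (h.map^[n] p) z).1 := by
      linear_combination l ^ n * z.1 * hlμ
    rw [e1, e2, Real.norm_eq_abs, abs_mul, abs_of_pos (pow_pos hl _)]
    have e3 : |(fderiv ℝ F (h.map^[n] p) z).1| ≤ A * (C₀ + 1) * ‖v‖ := by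
      refine (norm_fst_le _).trans ((norm_apply_le _ z).trans ?_)
      calc _ ≤ C₀ * l ^ n * (A * μ ^ n * ‖v‖) + 1 * (A * ‖v‖) := by
            gcongr
            · exact hFx p hp n
            · exact (h.norm_fderiv_le _).trans hε1
        _ = _ := by linear_combination C₀ * A * ‖v‖ * hln n
    calc _ ≤ l ^ n * (A * (C₀ + 1) * ‖v‖) :=
          mul_le_mul (pow_le_pow_of_le_one hl.le hl1.le (Nat.le_succ n)) e3 (abs_nonneg _)
            (by positivity)
      _ = _ := by ring
  obtain ⟨u, u', hu⟩ := exists_limit_hasFDerivAt isOpen_strip convex_strip.isPreconnected hfw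
    hl.le hl1 hdiff h0s (fun n => by rw [hf0, hf0])
  obtain ⟨Q, hQ⟩ : ∃ Q, Q = C * A + 2 * C₀ + 2 := ⟨_, rfl⟩
  have hQ0 : 0 ≤ Q := by rw [hQ]; positivity
  have hstep : ∀ p ∈ strip, ∀ q ∈ strip, ∀ i v,
      l ^ i * ‖(fderiv ℝ F (h.map^[i] p) - fderiv ℝ F (h.map^[i] q)) (fderiv ℝ h.map^[i] q v)‖ ≤
        2 * A * Q * min (μ ^ i * ‖p - q‖) (l ^ i) * ‖v‖ := by
    intro p hp q hq i v
    obtain ⟨k1, k2⟩ := hA q hq i v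
    set Δ := ‖p - q‖ with hΔ
    have hΔ0 : 0 ≤ Δ := norm_nonneg _
    set B := fderiv ℝ F (h.map^[i] p) - fderiv ℝ F (h.map^[i] q) with hB
    have b1 : ‖B‖ ≤ C * A * (μ ^ i * Δ) := by
      refine (h.lipschitz _ _).trans ?_
      calc _ ≤ C * (A * μ ^ i * Δ) := by gcongr; exact hdist p hp q hq i
        _ = _ := by ring
    have b2 : ‖B‖ ≤ 2 := by
      refine (norm_sub_le _ _).trans ?_
      linarith [h.norm_fderiv_le (h.map^[i] p), h.norm_fderiv_le (h.map^[i] q)]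
    have b3 : ‖B (1, 0)‖ ≤ 2 * C₀ * l ^ i := by
      rw [hB, sub_apply]
      refine (norm_sub_le _ _).trans ?_
      linarith [hFx p hp i, hFx q hq i]
    have b4 : ‖B (1, 0)‖ ≤ ‖B‖ := by simpa [Prod.norm_def] using B.le_opNorm (1, 0)
    have m1 : ‖B (1, 0)‖ ≤ Q * min (μ ^ i * Δ) (l ^ i) := by
      rw [mul_min_of_nonneg _ _ hQ0, hQ]
      refine le_min ((b4.trans b1).trans ?_) (b3.trans ?_)
      · gcongr
        linarith
      · gcongr
        nlinarith
    have m2 : l ^ i * ‖B‖ ≤ Q * min (μ ^ i * Δ) (l ^ i) := by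
      rw [mul_min_of_nonneg _ _ hQ0, hQ]
      refine le_min ?_ ?_
      · calc l ^ i * ‖B‖ ≤ 1 * (C * A * (μ ^ i * Δ)) := by
              gcongr
              exact pow_le_one₀ hl.le hl1.le
          _ ≤ (C * A + 2 * C₀ + 2) * (μ ^ i * Δ) := by
              rw [one_mul]
              gcongr
              linarith
      · rw [mul_comm]
        gcongr
        nlinarith
    have hm0 : 0 ≤ min (μ ^ i * Δ) (l ^ i) := by positivity
    calc _ ≤ l ^ i * (‖B (1, 0)‖ * (A * μ ^ i * ‖v‖) + ‖B‖ * (A * ‖v‖)) := by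
          gcongr
          refine (norm_apply_le _ _).trans ?_
          gcongr
      _ = A * ‖v‖ * (‖B (1, 0)‖ + l ^ i * ‖B‖) := by
          linear_combination ‖B (1, 0)‖ * A * ‖v‖ * hln i
      _ ≤ A * ‖v‖ * (Q * min (μ ^ i * Δ) (l ^ i) + Q * min (μ ^ i * Δ) (l ^ i)) := by gcongr
      _ = _ := by ring
  have htel : ∀ p ∈ strip, ∀ q ∈ strip, ∀ n i v,
      l ^ i * |(w n (h.map^[i] p) - w n (h.map^[i] q)) (fderiv ℝ h.map^[i] q v)| ≤
        ∑ j ∈ Finset.range n, 2 * A * A * Q * min (μ ^ (i + j) * ‖p - q‖) (l ^ (i + j)) * ‖v‖ := by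
    intro p hp q hq n
    induction n with
    | zero => intro i v; simp [hw]
    | succ n ih =>
      intro i v
      have hws : ∀ x y, w (n + 1) x y = l * w n (h.map x) ((diagCLM μ l + fderiv ℝ F x) y) :=
        fun x y => by
          rw [hwv, hwv, h.fderiv_iterate_succ, pow_succ', mul_assoc]
          rfl
      set z := fderiv ℝ h.map^[i] q v with hz
      set B := fderiv ℝ F (h.map^[i] p) - fderiv ℝ F (h.map^[i] q) with hB
      have e1 : (w (n + 1) (h.map^[i] p) - w (n + 1) (h.map^[i] q)) z =
          l * w n (h.map^[i + 1] p) (B z) +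
          l * (w n (h.map^[i + 1] p) - w n (h.map^[i + 1] q)) (fderiv ℝ h.map^[i + 1] q v) := by
        rw [sub_apply, hws, hws, h.fderiv_iterate_succ' i q,
          Function.iterate_succ_apply', Function.iterate_succ_apply', hB]
        simp only [sub_apply, add_apply, map_add, map_sub, ContinuousLinearMap.comp_apply]
        ring
      have e2 := ih (i + 1) v
      have e3 := hstep p hp q hq i v
      have e4 : |w n (h.map^[i + 1] p) (B z)| ≤ A * ‖B z‖ :=
        (w n (h.map^[i + 1] p)).le_of_opNorm_le (hwA _ (h.iterate_mem_strip hp _) n) _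
      rw [Finset.sum_range_succ', e1]
      have e5 : ∀ j, i + 1 + j = i + (j + 1) := fun j => by ring
      simp only [e5] at e2
      rw [add_comm]
      calc l ^ i * |_| ≤ l ^ i * (l * |(w n (h.map^[i + 1] p) - w n (h.map^[i + 1] q))
            (fderiv ℝ h.map^[i + 1] q v)| + l * (A * ‖B z‖)) := by
            gcongr
            refine (abs_add_le _ _).trans ?_
            rw [abs_mul, abs_mul, abs_of_pos hl]
            gcongr
        _ = l ^ (i + 1) * |(w n (h.map^[i + 1] p) - w n (h.map^[i + 1] q))
            (fderiv ℝ h.map^[i + 1] q v)| + l * (A * (l ^ i * ‖B z‖)) := by ring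
        _ ≤ _ := by
            rw [add_zero]
            refine add_le_add e2 ?_
            calc l * (A * (l ^ i * ‖B z‖)) ≤ 1 * (A * (l ^ i * ‖B z‖)) := by gcongr
              _ ≤ 1 * (A * (2 * A * Q * min (μ ^ i * ‖p - q‖) (l ^ i) * ‖v‖)) := by gcongr
              _ = _ := by ring
  refine ⟨u, u', 2 * A * A * Q * (2 / (1 - l)), fun p hp => (hu p hp).1, fun p hp q hq => ?_,
    ?_, ?_, fun p hp => ?_⟩
  · refine le_of_tendsto ((hu p hp).2.2.sub (hu q hq).2.2).norm (Eventually.of_forall fun n => ?_)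
    refine ContinuousLinearMap.opNorm_le_bound _ (by positivity) fun v => ?_
    have := htel p hp q hq n 0 v
    simp only [pow_zero, one_mul, zero_add, Function.iterate_zero, id, fderiv_id,
      ContinuousLinearMap.id_apply, ← Finset.mul_sum, ← Finset.sum_mul] at this
    refine this.trans ?_
    have hs := sum_min_pow_mul_le hμ hlμ n (norm_nonneg (p - q))
    calc _ ≤ 2 * A * A * Q * (2 / (1 - l) * √‖p - q‖) * ‖v‖ := by gcongr
      _ = _ := by ring
  · refine tendsto_nhds_unique (hu 0 h0s).2.1 ?_
    simp only [hf0]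
    exact tendsto_const_nhds
  · have hF0 : ∀ v, fderiv ℝ F 0 v = 0 := fun v => by
      have h1 : fderiv ℝ F 0 (1, 0) = 0 := h.fderiv_fst_axis 0
      have h2 : fderiv ℝ F 0 (0, 1) = 0 := h.fderiv_snd_axis 0
      have h3 : v = v.1 • ((1 : ℝ), (0 : ℝ)) + v.2 • ((0 : ℝ), (1 : ℝ)) := by simp
      rw [h3, map_add, map_smul, map_smul, h1, h2]
      simp
    have hw0 : ∀ n, w n 0 = ContinuousLinearMap.fst ℝ ℝ ℝ := fun n => by
      induction n with
      | zero =>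
        refine ContinuousLinearMap.ext fun v => ?_
        rw [hwv]
        simp
      | succ n ih =>
        refine ContinuousLinearMap.ext fun v => ?_
        have := DFunLike.congr_fun ih v
        rw [hwv] at this ⊢
        rw [h.fderiv_iterate_succ', hit0, ← this]
        simp only [ContinuousLinearMap.comp_apply, add_apply, hF0, add_zero, diagCLM_apply]
        linear_combination l ^ n * (fderiv ℝ h.map^[n] 0 v).1 * hlμ
    refine tendsto_nhds_unique (hu 0 h0s).2.2 ?_
    simp only [hw0]
    exact tendsto_const_nhds
  · refine tendsto_nhds_unique (hu _ (h.map_mem_strip hp)).2.1 ?_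
    have := ((hu p hp).2.1.comp (tendsto_add_atTop_nat 1)).const_mul μ
    refine this.congr fun n => ?_
    simp only [hf, Function.comp, Function.iterate_succ_apply]
    linear_combination l ^ n * (h.map^[n] (h.map p)).1 * hlμ

end IsSaddlePerturbation

/-- A map with small `C^{1,1}` norm on the unit ball which vanishes to second order at the origin
extends from a neighborhood of the origin to a map with small `C^{1,1}` norm. -/
theorem exists_cutoff_bound (E H : Type*) [NormedAddCommGroup E] [NormedSpace ℝ E]
    [FiniteDimensional ℝ E] [NormedAddCommGroup H] [NormedSpace ℝ H] :
    ∃ B : ℝ, 0 ≤ B ∧ ∀ (R : E → H) (δ : ℝ), 0 ≤ δ →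
      (∀ p ∈ Metric.ball 0 1, DifferentiableAt ℝ R p) →
      (∀ p ∈ Metric.ball 0 1, ∀ q ∈ Metric.ball 0 1,
        ‖fderiv ℝ R p - fderiv ℝ R q‖ ≤ δ * ‖p - q‖) →
      R 0 = 0 → fderiv ℝ R 0 = 0 →
      ∃ F : E → H, Differentiable ℝ F ∧ (∀ p, ‖fderiv ℝ F p‖ ≤ B * δ) ∧
        (∀ p q, ‖fderiv ℝ F p - fderiv ℝ F q‖ ≤ B * δ * ‖p - q‖) ∧
        (∀ p, 1 ≤ ‖p‖ → fderiv ℝ F p = 0) ∧ (∀ p, ‖p‖ < 1 → R p = 0 → F p = 0) ∧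
        (∀ p, 1 ≤ ‖p‖ → F p = 0) ∧ F =ᶠ[𝓝 0] R := by
  obtain ⟨φ, hφ⟩ : ∃ φ : ContDiffBump (0 : E), φ.rOut = 1 / 2 :=
    ⟨⟨1 / 4, 1 / 2, by norm_num, by norm_num⟩, rfl⟩
  have hφc : ContDiff ℝ 2 φ := φ.contDiff
  obtain ⟨L₁, hL₁⟩ := hφc.lipschitzWith_of_hasCompactSupport φ.hasCompactSupport (by simp)
  obtain ⟨L₂, hL₂⟩ := (hφc.fderiv_right (m := 1) (by norm_num)).lipschitzWith_of_hasCompactSupport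
    (φ.hasCompactSupport.fderiv ℝ) (by simp)
  have hD : ∀ p, ‖fderiv ℝ φ p‖ ≤ L₁ := fun p => norm_fderiv_le_of_lipschitz ℝ hL₁
  have hφd : Differentiable ℝ φ := hφc.differentiable (by simp)
  refine ⟨2 + 2 * L₁ + L₂, by positivity, fun R δ hδ hd hlip hR0 hDR0 => ?_⟩
  have h0 : (0 : E) ∈ Metric.ball (0 : E) 1 := by simp
  have hDR : ∀ p ∈ Metric.ball (0 : E) 1, ‖fderiv ℝ R p‖ ≤ δ := by
    intro p hp
    have := hlip p hp 0 h0
    rw [hDR0, sub_zero, sub_zero] at this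
    rw [mem_ball_zero_iff] at hp
    nlinarith
  have hRlip : ∀ p ∈ Metric.ball (0 : E) 1, ∀ q ∈ Metric.ball (0 : E) 1,
      ‖R p - R q‖ ≤ δ * ‖p - q‖ := fun p hp q hq =>
    (convex_ball _ _).norm_image_sub_le_of_norm_fderiv_le (𝕜 := ℝ) hd hDR hq hp
  have hRn : ∀ p ∈ Metric.ball (0 : E) 1, ‖R p‖ ≤ δ := by
    intro p hp
    have := hRlip p hp 0 h0
    rw [hR0, sub_zero, sub_zero] at this
    rw [mem_ball_zero_iff] at hp
    nlinarith
  set F : E → H := fun p => φ p • R p with hF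
  have hFz : ∀ p, 1 / 2 ≤ ‖p‖ → F p = 0 := by
    intro p hp
    simp only [hF]
    rw [φ.zero_of_le_dist (by rw [hφ, dist_zero_right]; exact hp), zero_smul]
  have hFin : ∀ p ∈ Metric.ball (0 : E) 1,
      HasFDerivAt F (φ p • fderiv ℝ R p + (fderiv ℝ φ p).smulRight (R p)) p := fun p hp =>
    (hφd p).hasFDerivAt.smul (hd p hp).hasFDerivAt
  have hFout : ∀ p : E, 1 / 2 < ‖p‖ → HasFDerivAt F (0 : E →L[ℝ] H) p := by
    intro p hp
    refine (hasFDerivAt_const (0 : H) p).congr_of_eventuallyEq ?_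
    filter_upwards [continuous_norm.continuousAt.eventually_const_lt hp] with x hx
    exact hFz x hx.le
  have hcase : ∀ p : E, p ∈ Metric.ball (0 : E) 1 ∨ 1 ≤ ‖p‖ := fun p => by
    rw [mem_ball_zero_iff]; exact lt_or_ge _ _
  have hφ1 : ∀ p, ‖φ p‖ ≤ 1 := fun p => by
    rw [Real.norm_of_nonneg φ.nonneg]; exact φ.le_one
  have hFn : ∀ p, ‖fderiv ℝ F p‖ ≤ (1 + L₁) * δ := by
    intro p
    rcases hcase p with hp | hp
    · rw [(hFin p hp).fderiv]
      refine (norm_add_le _ _).trans ?_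
      rw [norm_smul, ContinuousLinearMap.norm_smulRight_apply]
      calc _ ≤ 1 * δ + L₁ * δ := by
            gcongr
            exacts [hφ1 p, hDR p hp, hD p, hRn p hp]
        _ = _ := by ring
    · rw [(hFout p (by linarith)).fderiv, norm_zero]
      positivity
  have hone : ∀ p, 1 ≤ ‖p‖ → fderiv ℝ F p = 0 := fun p hp => (hFout p (by linarith)).fderiv
  have hmix : ∀ p ∈ Metric.ball (0 : E) 1, ∀ q, 1 ≤ ‖q‖ →
      ‖fderiv ℝ F p‖ ≤ (2 + 2 * L₁ + L₂) * δ * ‖p - q‖ := by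
    intro p hp q hq
    rcases lt_or_ge (1 / 2) ‖p‖ with h | h
    · rw [(hFout p h).fderiv, norm_zero]
      positivity
    · have h1 : 1 / 2 ≤ ‖p - q‖ := by
        have := norm_sub_norm_le q p
        rw [norm_sub_rev] at this
        linarith
      calc _ ≤ (1 + L₁) * δ := hFn p
        _ ≤ (2 + 2 * L₁ + L₂) * δ * (1 / 2) := by
          have : (0 : ℝ) ≤ L₂ * δ := by positivity
          linarith
        _ ≤ _ := by gcongr
  refine ⟨F, fun p => ?_, fun p => (hFn p).trans ?_, fun p q => ?_, hone, ?_,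
    fun p hp => hFz p (by linarith), ?_⟩
  · rcases hcase p with hp | hp
    · exact (hFin p hp).differentiableAt
    · exact (hFout p (by linarith)).differentiableAt
  · refine mul_le_mul_of_nonneg_right ?_ hδ
    have : (0 : ℝ) ≤ L₁ := L₁.2
    have : (0 : ℝ) ≤ L₂ := L₂.2
    linarith
  · rcases hcase p with hp | hp <;> rcases hcase q with hq | hq
    · rw [(hFin p hp).fderiv, (hFin q hq).fderiv]
      have e : φ p • fderiv ℝ R p + (fderiv ℝ φ p).smulRight (R p) -
          (φ q • fderiv ℝ R q + (fderiv ℝ φ q).smulRight (R q)) =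
          (φ p - φ q) • fderiv ℝ R p + φ q • (fderiv ℝ R p - fderiv ℝ R q) +
          ((fderiv ℝ φ p - fderiv ℝ φ q).smulRight (R p) +
            (fderiv ℝ φ q).smulRight (R p - R q)) := by
        ext v
        simp [sub_smul, smul_sub]
        abel
      rw [e]
      have hφl : ‖φ p - φ q‖ ≤ L₁ * ‖p - q‖ := by simpa [dist_eq_norm] using hL₁.dist_le_mul p q
      have hφl' : ‖fderiv ℝ φ p - fderiv ℝ φ q‖ ≤ L₂ * ‖p - q‖ := by
        simpa [dist_eq_norm] using hL₂.dist_le_mul p q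
      calc _ ≤ ‖φ p - φ q‖ * ‖fderiv ℝ R p‖ + ‖φ q‖ * ‖fderiv ℝ R p - fderiv ℝ R q‖ +
            (‖fderiv ℝ φ p - fderiv ℝ φ q‖ * ‖R p‖ + ‖fderiv ℝ φ q‖ * ‖R p - R q‖) := by
            refine (norm_add_le _ _).trans (add_le_add ((norm_add_le _ _).trans ?_)
              ((norm_add_le _ _).trans ?_))
            · rw [norm_smul, norm_smul]
            · rw [ContinuousLinearMap.norm_smulRight_apply,
                ContinuousLinearMap.norm_smulRight_apply]
        _ ≤ L₁ * ‖p - q‖ * δ + 1 * (δ * ‖p - q‖) +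
            (L₂ * ‖p - q‖ * δ + L₁ * (δ * ‖p - q‖)) := by
            gcongr
            exacts [hDR p hp, hφ1 q, hlip p hp q hq, hRn p hp, hD q, hRlip p hp q hq]
        _ ≤ _ := by
            have : 0 ≤ δ * ‖p - q‖ := by positivity
            linarith
    · rw [hone q hq, sub_zero]
      exact hmix p hp q hq
    · rw [hone p hp, zero_sub, norm_neg, norm_sub_rev p q]
      exact hmix q hq p hp
    · rw [hone p hp, hone q hq, sub_zero, norm_zero]
      positivity
  · intro p _ hp
    simp only [hF, hp, smul_zero]
  · filter_upwards [φ.eventuallyEq_one] with p hp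
    simp only [hF, hp, Pi.one_apply, one_smul]

/-- A local `C^{1,1}` saddle map preserving the axes, linear on them, has a `C^{1,1/2}` coordinate
linearizing the expanding direction. -/
theorem exists_local_linearizing_coordinate {G : ℝ × ℝ → ℝ × ℝ} (hG : HolderDiffAt 1 G 0)
    {μ l : ℝ} (hμ : 1 < μ) (hlμ : l * μ = 1) (hx : ∀ᶠ x : ℝ in 𝓝 0, G (x, 0) = (μ * x, 0))
    (hy : ∀ᶠ y : ℝ in 𝓝 0, G (0, y) = (0, l * y)) :
    ∃ u : ℝ × ℝ → ℝ, HolderDiffAt (1 / 2) u 0 ∧ u 0 = 0 ∧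
      HasFDerivAt u (ContinuousLinearMap.fst ℝ ℝ ℝ) 0 ∧ ∀ᶠ p in 𝓝 0, u (G p) = μ * u p := by
  have hμ0 : 0 < μ := by linarith
  have hl1 : l < 1 := by
    by_contra h
    nlinarith
  have hG0 : G 0 = 0 := by exact (hx.self_of_nhds).trans (by simp)
  obtain ⟨r, hr, K, hK, hGd, hGl⟩ := hG.exists_ball
  simp only [Real.rpow_one] at hGl
  have hDG : fderiv ℝ G 0 = diagCLM μ l := by
    have h0 := ((hGd 0 (by simpa)).hasFDerivAt)
    have h1 : HasDerivAt (fun x : ℝ => (x, (0 : ℝ))) (1, 0) 0 :=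
      (hasDerivAt_id _).prodMk (hasDerivAt_const _ 0)
    have h2 : HasDerivAt (fun y : ℝ => ((0 : ℝ), y)) (0, 1) 0 :=
      (hasDerivAt_const _ 0).prodMk (hasDerivAt_id _)
    have h3 : HasDerivAt (fun x : ℝ => (μ * x, (0 : ℝ))) (μ, 0) 0 := by
      simpa using ((hasDerivAt_id (0 : ℝ)).const_mul μ).prodMk (hasDerivAt_const (0 : ℝ) (0 : ℝ))
    have h4 : HasDerivAt (fun y : ℝ => ((0 : ℝ), l * y)) (0, l) 0 := by
      simpa using (hasDerivAt_const (0 : ℝ) (0 : ℝ)).prodMk ((hasDerivAt_id (0 : ℝ)).const_mul l)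
    have e1 : fderiv ℝ G 0 (1, 0) = (μ, 0) :=
      (HasFDerivAt.comp_hasDerivAt (f := fun x : ℝ => (x, (0 : ℝ))) (0 : ℝ) h0 h1).unique
        (h3.congr_of_eventuallyEq hx)
    have e2 : fderiv ℝ G 0 (0, 1) = (0, l) :=
      (HasFDerivAt.comp_hasDerivAt (f := fun y : ℝ => ((0 : ℝ), y)) (0 : ℝ) h0 h2).unique
        (h4.congr_of_eventuallyEq hy)
    ext <;> simp [e1, e2]
  obtain ⟨B, hB0, hB⟩ := exists_cutoff_bound (ℝ × ℝ) (ℝ × ℝ)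
  obtain ⟨r₁, hr₁, hx₁⟩ := Metric.eventually_nhds_iff_ball.1 hx
  obtain ⟨r₂, hr₂, hy₂⟩ := Metric.eventually_nhds_iff_ball.1 hy
  obtain ⟨s, hs, hsr, hsr₁, hsr₂, hsB⟩ : ∃ s > 0, s ≤ r ∧ s ≤ r₁ ∧ s ≤ r₂ ∧
      B * (K * s) ≤ (1 - l) / 2 := by
    have hs : 0 < (1 - l) / (2 * (B * K + 1)) := div_pos (by linarith) (by positivity)
    refine ⟨min (min r r₁) (min r₂ ((1 - l) / (2 * (B * K + 1)))), by positivity, by simp,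
      by simp, by simp, ?_⟩
    calc B * (K * _) ≤ B * (K * ((1 - l) / (2 * (B * K + 1)))) := by
          gcongr
          exact (min_le_right _ _).trans (min_le_right _ _)
      _ = (1 - l) / 2 * (B * K / (B * K + 1)) := by field_simp
      _ ≤ (1 - l) / 2 * 1 := by
          refine mul_le_mul_of_nonneg_left ?_ (by linarith)
          rw [div_le_one (by positivity)]; linarith
      _ = _ := mul_one _
  have hmem : ∀ p ∈ Metric.ball (0 : ℝ × ℝ) 1, s • p ∈ Metric.ball (0 : ℝ × ℝ) r := by
    intro p hp
    rw [mem_ball_zero_iff] at hp ⊢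
    rw [norm_smul, Real.norm_of_nonneg hs.le]
    nlinarith
  set R : ℝ × ℝ → ℝ × ℝ := fun p => s⁻¹ • G (s • p) - diagCLM μ l p with hR
  have hRd : ∀ p ∈ Metric.ball (0 : ℝ × ℝ) 1,
      HasFDerivAt R (fderiv ℝ G (s • p) - diagCLM μ l) p := by
    intro p hp
    have h1 : HasFDerivAt (fun p : ℝ × ℝ => s • p) (s • ContinuousLinearMap.id ℝ (ℝ × ℝ)) p :=
      (hasFDerivAt_id p).const_smul s
    have h2 := (((hGd _ (hmem p hp)).hasFDerivAt.comp p h1).const_smul s⁻¹).sub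
      (diagCLM μ l).hasFDerivAt
    refine HasFDerivAt.congr_fderiv (f := R) h2 ?_
    ext <;> simp [hs.ne']
  obtain ⟨F, hFd, hFn, hFl, hF1, hFR, hFo, hFe⟩ := hB R (K * s) (by positivity)
    (fun p hp => (hRd p hp).differentiableAt)
    (fun p hp q hq => by
      rw [(hRd p hp).fderiv, (hRd q hq).fderiv, sub_sub_sub_cancel_right]
      refine (hGl _ (hmem p hp) _ (hmem q hq)).trans (le_of_eq ?_)
      rw [← smul_sub, norm_smul, Real.norm_of_nonneg hs.le, mul_assoc])
    (by simp [hR, hG0])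
    (by rw [(hRd 0 (by simp)).fderiv, smul_zero, hDG, sub_self])
  have hS : IsSaddlePerturbation μ l (B * (K * s)) (B * (K * s)) F :=
    { one_lt := hμ
      mul_eq := hlμ
      C_nonneg := by positivity
      eps_nonneg := by positivity
      eps_le := hsB
      differentiable := hFd
      lipschitz := hFl
      norm_fderiv_le := hFn
      fderiv_eq_zero := fun p hp => hF1 p (hp.trans (norm_fst_le p))
      fst_axis := fun x => by
        rcases lt_or_ge ‖(x, (0 : ℝ))‖ 1 with h | h
        · refine hFR _ h ?_
          have h' : |x| < 1 := by simpa [Prod.norm_def] using h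
          have := hx₁ (s * x) (by
            rw [mem_ball_zero_iff, Real.norm_eq_abs, abs_mul, abs_of_pos hs]; nlinarith)
          simp only [hR, Prod.smul_mk, smul_eq_mul, mul_zero, this, diagCLM_apply]
          ext <;> simp
          field_simp
          ring
        · exact hFo _ h
      snd_axis := fun y => by
        rcases lt_or_ge ‖((0 : ℝ), y)‖ 1 with h | h
        · refine hFR _ h ?_
          have h' : |y| < 1 := by simpa [Prod.norm_def] using h
          have := hy₂ (s * y) (by
            rw [mem_ball_zero_iff, Real.norm_eq_abs, abs_mul, abs_of_pos hs]; nlinarith)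
          simp only [hR, Prod.smul_mk, smul_eq_mul, mul_zero, this, diagCLM_apply]
          ext <;> simp
          field_simp
          ring
        · exact hFo _ h }
  obtain ⟨u, u', M, hu, hu', hu0, hu'0, huF⟩ :=
    IsSaddlePerturbation.exists_linearizing_coordinate hS
  have hstrip : IsSaddlePerturbation.strip ∈ 𝓝 (0 : ℝ × ℝ) :=
    IsSaddlePerturbation.isOpen_strip.mem_nhds (by simp [IsSaddlePerturbation.strip])
  have hc : HolderDiffAt (1 / 2) u 0 := by
    refine .of_eventually (f' := u') (K := M) (Filter.eventually_of_mem hstrip hu) ?_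
    rw [nhds_prod_eq]
    filter_upwards [prod_mem_prod hstrip hstrip] with z hz
    rw [← Real.sqrt_eq_rpow]
    exact hu' _ hz.1 _ hz.2
  have hsc : HolderDiffAt (1 / 2) (fun p : ℝ × ℝ => s⁻¹ • p) 0 :=
    (HolderDiffAt.of_contDiffAt (by fun_prop)).of_le (by norm_num) (by norm_num)
  have hsc' : HolderDiffAt (1 / 2) (fun x : ℝ => s * x) (u (s⁻¹ • 0)) :=
    (HolderDiffAt.of_contDiffAt (by fun_prop)).of_le (by norm_num) (by norm_num)
  have hcont : Tendsto (fun p : ℝ × ℝ => s⁻¹ • p) (𝓝 0) (𝓝 0) :=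
    (continuous_const_smul s⁻¹).tendsto' _ _ (smul_zero _)
  refine ⟨fun p => s * u (s⁻¹ • p), HolderDiffAt.comp (g := fun x : ℝ => s * x)
    (f := fun p : ℝ × ℝ => u (s⁻¹ • p)) (by norm_num) hsc'
    (HolderDiffAt.comp (g := u) (f := fun p : ℝ × ℝ => s⁻¹ • p) (by norm_num)
      (by rwa [smul_zero]) hsc), by simp [hu0], ?_, ?_⟩
  · have h1 : HasFDerivAt (fun p : ℝ × ℝ => s⁻¹ • p) (s⁻¹ • ContinuousLinearMap.id ℝ (ℝ × ℝ)) 0 :=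
      (hasFDerivAt_id (0 : ℝ × ℝ)).const_smul s⁻¹
    have h2 : HasFDerivAt u (u' 0) (s⁻¹ • (0 : ℝ × ℝ)) := by
      rw [smul_zero]; exact hu 0 (mem_of_mem_nhds hstrip)
    have h3 := (h2.comp (0 : ℝ × ℝ) h1).const_mul s
    refine h3.congr_fderiv ?_
    rw [hu'0]
    ext <;> simp [hs.ne']
  · filter_upwards [hcont.eventually hFe, hcont.eventually hstrip] with p hp hp'
    have h1 := huF _ hp'
    have h2 : IsSaddlePerturbation.map hS (s⁻¹ • p) = s⁻¹ • G p := by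
      rw [IsSaddlePerturbation.map, hp]
      simp only [hR, smul_smul, mul_inv_cancel₀ hs.ne', one_smul]
      abel
    rw [h2] at h1
    rw [h1]
    ring

theorem HolderDiffAt.prodMk {E F G : Type*} [NormedAddCommGroup E] [NormedSpace ℝ E]
    [NormedAddCommGroup F] [NormedSpace ℝ F] [NormedAddCommGroup G] [NormedSpace ℝ G] {α : ℝ}
    {f : E → F} {g : E → G} {p : E} (hf : HolderDiffAt α f p) (hg : HolderDiffAt α g p) :
    HolderDiffAt α (fun x => (f x, g x)) p := by
  refine ⟨(hf.1.and hg.1).mono fun x hx => hx.1.prodMk hx.2, ?_⟩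
  have h1 : ∀ᶠ z : E × E in 𝓝 (p, p), (DifferentiableAt ℝ f z.1 ∧ DifferentiableAt ℝ g z.1) ∧
      DifferentiableAt ℝ f z.2 ∧ DifferentiableAt ℝ g z.2 := by
    rw [nhds_prod_eq]
    exact (hf.1.and hg.1).prod_mk (hf.1.and hg.1)
  refine .of_norm_left ((hf.2.prod_left hg.2).norm_left.congr' ?_ EventuallyEq.rfl)
  filter_upwards [h1] with z hz
  rw [hz.1.1.fderiv_prodMk hz.1.2, hz.2.1.fderiv_prodMk hz.2.2, ← ContinuousLinearMap.opNorm_prod]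
  rfl

/-- The invertible linear map `(x, y) ↦ (a x, b y)`. -/
def diagCLE {a b : ℝ} (h : a * b = 1) : (ℝ × ℝ) ≃L[ℝ] ℝ × ℝ :=
  ContinuousLinearEquiv.equivOfInverse (diagCLM a b) (diagCLM b a)
    (fun p => by ext <;> simp [← mul_assoc, h, mul_comm b a])
    (fun p => by ext <;> simp [← mul_assoc, h, mul_comm b a])

theorem norm_diagCLM_le {a b c : ℝ} (ha : |a| ≤ c) (hb : |b| ≤ c) : ‖diagCLM a b‖ ≤ c := by
  have hc : 0 ≤ c := (abs_nonneg a).trans ha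
  refine ContinuousLinearMap.opNorm_le_bound _ hc fun p => ?_
  rw [diagCLM_apply, Prod.norm_def, Prod.norm_def, mul_max_of_nonneg _ _ hc, norm_mul, norm_mul]
  exact max_le_max (mul_le_mul_of_nonneg_right ha (norm_nonneg _))
    (mul_le_mul_of_nonneg_right hb (norm_nonneg _))

/-- A planar `C^{1,1}` saddle map in diagonal form has a local `C^{1,1/2}` linearization. -/
theorem exists_linearization_of_diag {g : ℝ × ℝ → ℝ × ℝ} (hg : HolderDiffAt 1 g 0)
    (hg0 : g 0 = 0) {μ l : ℝ} (hμ : 1 < μ) (hlμ : l * μ = 1)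
    (hDg : fderiv ℝ g 0 = diagCLM l μ) :
    ∃ Θ : ℝ × ℝ → ℝ × ℝ, HolderDiffAt (1 / 2) Θ 0 ∧ Θ 0 = 0 ∧
      HasFDerivAt Θ (ContinuousLinearMap.id ℝ (ℝ × ℝ)) 0 ∧
      ∀ᶠ z in 𝓝 0, Θ (g z) = diagCLM l μ (Θ z) := by
  have hμ0 : 0 < μ := by linarith
  have hl0 : 0 < l := pos_of_mul_pos_left (by rw [hlμ]; exact one_pos) hμ0.le
  have hl1 : l ≤ 1 := by nlinarith
  have hn1 : ‖diagCLM μ l‖ ≤ μ :=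
    norm_diagCLM_le (abs_of_pos hμ0).le (by rw [abs_of_pos hl0]; linarith)
  have hn2 : ‖diagCLM l μ‖ ≤ μ :=
    norm_diagCLM_le (by rw [abs_of_pos hl0]; linarith) (abs_of_pos hμ0).le
  obtain ⟨e, he, he0, heH, heD⟩ := hg.exists_localInverse one_pos (A := diagCLE hlμ) hDg
  rw [hg0] at heH heD
  have hG0 : e.symm 0 = 0 := by
    have := e.left_inv he0
    rwa [he, hg0] at this
  have hgG : ∀ᶠ z in 𝓝 0, g (e.symm z) = z := by
    have := e.eventually_right_inverse' he0
    rwa [he, hg0] at this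
  have hGg : ∀ᶠ z in 𝓝 0, e.symm (g z) = z := by
    have := e.eventually_left_inverse he0
    rwa [he] at this
  set G := e.symm with hG
  have hDG : fderiv ℝ G 0 = diagCLM μ l := heD.fderiv
  obtain ⟨γ₁, h₁, h₁0, h₁D, h₁G⟩ := exists_unstable_curve heH hG0 hμ (by rwa [hDG])
    (e := ((1 : ℝ), (0 : ℝ))) (by simp [Prod.norm_def]) (by rw [hDG]; simp)
  obtain ⟨γ₂, h₂, h₂0, h₂D, h₂g⟩ := exists_unstable_curve hg hg0 hμ (by rwa [hDg])
    (e := ((0 : ℝ), (1 : ℝ))) (by simp [Prod.norm_def]) (by rw [hDg]; simp)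
  have hlt : Tendsto (fun t : ℝ => l * t) (𝓝 0) (𝓝 0) :=
    (continuous_const_mul l).tendsto' _ _ (mul_zero _)
  have hμt : Tendsto (fun t : ℝ => μ * t) (𝓝 0) (𝓝 0) :=
    (continuous_const_mul μ).tendsto' _ _ (mul_zero _)
  have hμl : ∀ t, μ * (l * t) = t := fun t => by rw [← mul_assoc, mul_comm μ, hlμ, one_mul]
  have c₁ : Tendsto γ₁ (𝓝 0) (𝓝 0) := by simpa [ContinuousAt, h₁0] using h₁D.continuousAt
  have c₂ : Tendsto γ₂ (𝓝 0) (𝓝 0) := by simpa [ContinuousAt, h₂0] using h₂D.continuousAt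
  have h₁g : ∀ᶠ t in 𝓝 0, g (γ₁ t) = γ₁ (l * t) := by
    filter_upwards [hlt.eventually h₁G, (c₁.comp hlt).eventually hgG] with t ht ht'
    rw [hμl] at ht
    rw [← ht]
    exact ht'
  have h₂G : ∀ᶠ t in 𝓝 0, G (γ₂ t) = γ₂ (l * t) := by
    filter_upwards [hlt.eventually h₂g, (c₂.comp hlt).eventually hGg] with t ht ht'
    rw [hμl] at ht
    rw [← ht]
    exact ht'
  set H : ℝ × ℝ → ℝ × ℝ := fun p => γ₁ p.1 + γ₂ p.2 with hH
  have hHH : HolderDiffAt 1 H 0 :=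
    HolderDiffAt.comp (g := fun q : (ℝ × ℝ) × ℝ × ℝ => q.1 + q.2)
      (f := fun p : ℝ × ℝ => (γ₁ p.1, γ₂ p.2)) one_pos
      (HolderDiffAt.of_contDiffAt (by fun_prop))
      (HolderDiffAt.prodMk
        (HolderDiffAt.comp (f := fun p : ℝ × ℝ => p.1) one_pos h₁
          (HolderDiffAt.of_contDiffAt (by fun_prop)))
        (HolderDiffAt.comp (f := fun p : ℝ × ℝ => p.2) one_pos h₂
          (HolderDiffAt.of_contDiffAt (by fun_prop))))
  have hHD : fderiv ℝ H 0 = (ContinuousLinearEquiv.refl ℝ (ℝ × ℝ) : ℝ × ℝ →L[ℝ] ℝ × ℝ) := by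
    have h1 : HasFDerivAt (fun p : ℝ × ℝ => γ₁ p.1) _ 0 :=
      HasFDerivAt.comp (f := fun p : ℝ × ℝ => p.1) (0 : ℝ × ℝ) h₁D hasFDerivAt_fst
    have h2 : HasFDerivAt (fun p : ℝ × ℝ => γ₂ p.2) _ 0 :=
      HasFDerivAt.comp (f := fun p : ℝ × ℝ => p.2) (0 : ℝ × ℝ) h₂D hasFDerivAt_snd
    rw [HasFDerivAt.fderiv (f := H) (h1.add h2)]
    ext <;> simp
  have hH0 : H 0 = 0 := by simp [hH, h₁0, h₂0]
  have hH1 : ∀ t, H (t, 0) = γ₁ t := fun t => by simp [hH, h₂0]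
  have hH2 : ∀ t, H (0, t) = γ₂ t := fun t => by simp [hH, h₁0]
  obtain ⟨f, hf, hf0, hfH, hfD⟩ := hHH.exists_localInverse one_pos hHD
  rw [hH0] at hfH hfD
  have hK0 : f.symm 0 = 0 := by
    have := f.left_inv hf0
    rwa [hf, hH0] at this
  have hHK : ∀ᶠ z in 𝓝 0, H (f.symm z) = z := by
    have := f.eventually_right_inverse' hf0
    rwa [hf, hH0] at this
  have hKH : ∀ᶠ z in 𝓝 0, f.symm (H z) = z := by
    have := f.eventually_left_inverse hf0
    rwa [hf] at this
  set K := f.symm with hK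
  have cK : Tendsto K (𝓝 0) (𝓝 0) := by simpa [ContinuousAt, hK0] using hfD.continuousAt
  have cg : Tendsto g (𝓝 0) (𝓝 0) := by
    simpa [ContinuousAt, hg0] using (hg.hasStrictFDerivAt one_pos).continuousAt
  have t1 : Tendsto (fun t : ℝ => (t, (0 : ℝ))) (𝓝 0) (𝓝 0) :=
    (continuous_id.prodMk continuous_const).tendsto' _ _ rfl
  have t2 : Tendsto (fun t : ℝ => ((0 : ℝ), t)) (𝓝 0) (𝓝 0) :=
    (continuous_const.prodMk continuous_id).tendsto' _ _ rfl
  have k1 : ∀ᶠ t in 𝓝 0, K (γ₁ t) = (t, 0) :=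
    (t1.eventually hKH).mono fun t ht => by rwa [hH1] at ht
  have k2 : ∀ᶠ t in 𝓝 0, K (γ₂ t) = (0, t) :=
    (t2.eventually hKH).mono fun t ht => by rwa [hH2] at ht
  have hconj : ∀ φ : ℝ × ℝ → ℝ × ℝ, HolderDiffAt 1 φ 0 → φ 0 = 0 →
      HolderDiffAt 1 (fun p => K (φ (H p))) 0 := fun φ hφ hφ0 =>
    HolderDiffAt.comp (f := fun p => φ (H p)) one_pos (by rwa [hH0, hφ0])
      (HolderDiffAt.comp one_pos (by rwa [hH0]) hHH)
  obtain ⟨u, hu, hu0, huD, huG⟩ := exists_local_linearizing_coordinate (hconj G heH hG0) hμ hlμ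
    (by
      filter_upwards [h₁G, hμt.eventually k1] with t ht ht'
      rw [hH1, ht, ht'])
    (by
      filter_upwards [h₂G, hlt.eventually k2] with t ht ht'
      rw [hH2, ht, ht'])
  set S : ℝ × ℝ → ℝ × ℝ := fun p => (p.2, p.1) with hS
  have hSd : ∀ p, HolderDiffAt 1 S p := fun p => HolderDiffAt.of_contDiffAt (by fun_prop)
  have cS : Tendsto S (𝓝 0) (𝓝 0) :=
    (continuous_snd.prodMk continuous_fst).tendsto' _ _ rfl
  have hS0 : S 0 = 0 := rfl
  obtain ⟨v, hv, hv0, hvD, hvg⟩ := exists_local_linearizing_coordinate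
    (G := fun p => S (K (g (H (S p)))))
    (HolderDiffAt.comp (f := fun p => K (g (H (S p)))) one_pos (hSd _)
      (HolderDiffAt.comp (g := fun p => K (g (H p))) one_pos (hconj g hg hg0) (hSd 0))) hμ hlμ
    (by
      filter_upwards [h₂g, hμt.eventually k2] with t ht ht'
      simp only [hS]
      rw [hH2, ht, ht'])
    (by
      filter_upwards [h₁g, hlt.eventually k1] with t ht ht'
      simp only [hS]
      rw [hH1, ht, ht'])
  have hhalf : (0 : ℝ) < 1 / 2 := by norm_num
  have hK' : HolderDiffAt (1 / 2) K 0 := hfH.of_le hhalf (by norm_num)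
  have hSK : HolderDiffAt (1 / 2) (fun z => S (K z)) 0 :=
    HolderDiffAt.comp hhalf ((hSd _).of_le hhalf (by norm_num)) hK'
  refine ⟨fun z => (u (K z), v (S (K z))), HolderDiffAt.prodMk
    (HolderDiffAt.comp hhalf (by rwa [hK0]) hK')
    (HolderDiffAt.comp (f := fun z => S (K z)) hhalf (by rwa [hK0]) hSK),
    by simp [hK0, hS0, hu0, hv0], ?_, ?_⟩
  · have d1 : HasFDerivAt (fun z => u (K z)) _ 0 :=
      HasFDerivAt.comp (g := u) (0 : ℝ × ℝ) (by rw [hK0]; exact huD) hfD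
    have d2 : HasFDerivAt S
        ((ContinuousLinearMap.snd ℝ ℝ ℝ).prod (ContinuousLinearMap.fst ℝ ℝ ℝ)) (K 0) :=
      hasFDerivAt_snd.prodMk hasFDerivAt_fst
    have d3 : HasFDerivAt (fun z => v (S (K z))) _ 0 :=
      HasFDerivAt.comp (g := v) (f := fun z => S (K z)) (0 : ℝ × ℝ) (by rw [hK0]; exact hvD)
        (HasFDerivAt.comp (g := S) (0 : ℝ × ℝ) d2 hfD)
    refine (d1.prodMk d3).congr_fderiv ?_
    ext <;> simp
  · filter_upwards [(cK.comp cg).eventually huG, (cS.comp cK).eventually hvg, hHK,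
      cg.eventually hHK, hGg] with z z1 z2 z3 z4 z5
    simp only [Function.comp_apply] at z1 z2
    rw [z4, z5] at z1
    have z2' : v (S (K (g z))) = μ * v (S (K z)) := by
      have : S (S (K z)) = K z := rfl
      rwa [this, z3] at z2
    rw [diagCLM_apply, z2', z1, ← mul_assoc, hlμ, one_mul]

/-- Two eigenvectors of a planar linear map with different eigenvalues diagonalize it. -/
theorem exists_diagonalization {A : ℝ × ℝ →L[ℝ] ℝ × ℝ} {a b : ℝ} (hab : a ≠ b)
    (ha : Module.End.HasEigenvalue (A : ℝ × ℝ →ₗ[ℝ] ℝ × ℝ) a)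
    (hb : Module.End.HasEigenvalue (A : ℝ × ℝ →ₗ[ℝ] ℝ × ℝ) b) :
    ∃ T : (ℝ × ℝ) ≃L[ℝ] ℝ × ℝ, ∀ p, A (T p) = T (diagCLM a b p) := by
  obtain ⟨v, hv⟩ := ha.exists_hasEigenvector
  obtain ⟨w, hw⟩ := hb.exists_hasEigenvector
  have hv1 : A v = a • v := hv.apply_eq_smul
  have hw1 : A w = b • w := hw.apply_eq_smul
  have hv0 := hv.2
  have hw0 := hw.2
  set L : ℝ × ℝ →ₗ[ℝ] ℝ × ℝ :=
    (LinearMap.toSpanSingleton ℝ (ℝ × ℝ) v).coprod (LinearMap.toSpanSingleton ℝ (ℝ × ℝ) w) with hL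
  have hLp : ∀ p, L p = p.1 • v + p.2 • w := fun p => by simp [hL]
  have hinj : Function.Injective L := by
    rw [injective_iff_map_eq_zero]
    intro p hp
    rw [hLp] at hp
    have h1 : p.1 • a • v + p.2 • b • w = 0 := by
      rw [← hv1, ← hw1, ← map_smul, ← map_smul, ← map_add, hp, map_zero]
    have h2 : ((a - b) * p.2) • w = 0 := by
      have : ((a - b) * p.2) • w = a • (p.1 • v + p.2 • w) - (p.1 • a • v + p.2 • b • w) := by
        module
      rw [this, hp, h1, smul_zero, sub_zero]
    have h3 : p.2 = 0 := by
      simpa [hw0, sub_ne_zero.2 hab] using h2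
    have h4 : p.1 = 0 := by simpa [h3, hv0] using hp
    exact Prod.ext h4 h3
  refine ⟨(LinearEquiv.ofInjectiveEndo L hinj).toContinuousLinearEquiv, fun p => ?_⟩
  have : ∀ q, (LinearEquiv.ofInjectiveEndo L hinj).toContinuousLinearEquiv q = L q := fun q => rfl
  rw [this, this, hLp, hLp, map_add, map_smul, map_smul, hv1, hw1, diagCLM_apply]
  module

/-- A planar `C^{1,1}` map with a hyperbolic fixed point with eigenvalues `l` and `l⁻¹` has a local
`C^{1,1/2}` linearization. -/
theorem exists_linearization {g : ℝ × ℝ → ℝ × ℝ} {P : ℝ × ℝ} (hg : HolderDiffAt 1 g P)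
    (hgP : g P = P) {l : ℝ} (hl0 : 0 < l) (hl1 : l < 1)
    (heig : Module.End.HasEigenvalue ((fderiv ℝ g P) : ℝ × ℝ →ₗ[ℝ] ℝ × ℝ) l)
    (heig' : Module.End.HasEigenvalue ((fderiv ℝ g P) : ℝ × ℝ →ₗ[ℝ] ℝ × ℝ) l⁻¹) :
    ∃ Θ : ℝ × ℝ → ℝ × ℝ, HolderDiffAt (1 / 2) Θ P ∧ Θ P = P ∧
      HasFDerivAt Θ (ContinuousLinearMap.id ℝ (ℝ × ℝ)) P ∧
      ∀ᶠ z in 𝓝 P, Θ (g z) = P + fderiv ℝ g P (Θ z - P) := by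
  have hl1' : 1 < l⁻¹ := (one_lt_inv₀ hl0).2 hl1
  obtain ⟨T, hT⟩ := exists_diagonalization (by linarith) heig heig'
  have hT1 : ∀ p, HolderDiffAt 1 (fun p => P + T p) p := fun p =>
    HolderDiffAt.of_contDiffAt (by fun_prop)
  have hT2 : ∀ p, HolderDiffAt 1 (fun p => T.symm (p - P)) p := fun p =>
    HolderDiffAt.of_contDiffAt (by fun_prop)
  have e0 : P + T 0 = P := by simp
  have eP : T.symm (P - P) = 0 := by simp
  have hT1d : ∀ p, HasFDerivAt (fun p => P + T p) (T : ℝ × ℝ →L[ℝ] ℝ × ℝ) p := fun p =>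
    T.hasFDerivAt.const_add P
  have hT2d : ∀ p, HasFDerivAt (fun p => T.symm (p - P)) (T.symm : ℝ × ℝ →L[ℝ] ℝ × ℝ) p :=
    fun p => HasFDerivAt.comp (f := fun p => p - P) p T.symm.hasFDerivAt
      ((hasFDerivAt_id p).sub_const P)
  have hgd : HasFDerivAt g (fderiv ℝ g P) P := hg.1.self_of_nhds.hasFDerivAt
  have hg0d : HasFDerivAt (fun p => T.symm (g (P + T p) - P)) (diagCLM l l⁻¹) 0 := by
    have h1 : HasFDerivAt (fun p => g (P + T p)) _ 0 :=
      HasFDerivAt.comp (g := g) (f := fun p => P + T p) (0 : ℝ × ℝ) (by rw [e0]; exact hgd)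
        (hT1d 0)
    refine (HasFDerivAt.comp (f := fun p => g (P + T p)) (0 : ℝ × ℝ) (hT2d _) h1).congr_fderiv ?_
    refine ContinuousLinearMap.ext fun p => ?_
    simp [hT]
  obtain ⟨Θ, h1, h2, h3, h4⟩ := exists_linearization_of_diag
    (g := fun p => T.symm (g (P + T p) - P))
    (HolderDiffAt.comp (g := fun p => T.symm (p - P)) (f := fun p => g (P + T p)) one_pos (hT2 _)
      (HolderDiffAt.comp (f := fun p => P + T p) one_pos (by rwa [e0]) (hT1 0)))
    (by simp [hgP]) hl1' (mul_inv_cancel₀ hl0.ne') hg0d.fderiv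
  have hhalf : (0 : ℝ) < 1 / 2 := by norm_num
  have hhalf' : (1 / 2 : ℝ) ≤ 1 := by norm_num
  refine ⟨fun z => P + T (Θ (T.symm (z - P))),
    HolderDiffAt.comp (g := fun p => P + T p) (f := fun z => Θ (T.symm (z - P))) hhalf
      ((hT1 _).of_le hhalf hhalf')
      (HolderDiffAt.comp (f := fun z => T.symm (z - P)) hhalf (by rwa [eP])
        ((hT2 _).of_le hhalf hhalf')), by simp [h2], ?_, ?_⟩
  · have d1 : HasFDerivAt (fun z => Θ (T.symm (z - P))) _ P :=
      HasFDerivAt.comp (g := Θ) (f := fun z => T.symm (z - P)) P (by rw [eP]; exact h3) (hT2d P)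
    refine (HasFDerivAt.comp (f := fun z => Θ (T.symm (z - P))) P (hT1d _) d1).congr_fderiv ?_
    refine ContinuousLinearMap.ext fun p => ?_
    simp
  · have c : Tendsto (fun z => T.symm (z - P)) (𝓝 P) (𝓝 0) := by
      have : Continuous fun z => T.symm (z - P) := by fun_prop
      exact this.tendsto' _ _ eP
    filter_upwards [c.eventually h4] with z hz
    simp only [ContinuousLinearEquiv.apply_symm_apply, add_sub_cancel] at hz
    simp only [hz, add_sub_cancel_left, hT]

theorem c1Half_of_holder {f : ℝ × ℝ → ℝ × ℝ} {s : Set (ℝ × ℝ)} (hs : IsOpen s) {K : ℝ}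
    (hK : 0 ≤ K) (hd : ∀ x ∈ s, DifferentiableAt ℝ f x)
    (hf : ∀ x ∈ s, ∀ y ∈ s, ‖fderiv ℝ f x - fderiv ℝ f y‖ ≤ K * ‖x - y‖ ^ (1 / 2 : ℝ)) :
    C1Half f s := by
  have hH : HolderOnWith K.toNNReal (1 / 2 : NNReal) (fderiv ℝ f) s := by
    intro x hx y hy
    rw [edist_dist, edist_dist, dist_eq_norm, dist_eq_norm,
      ENNReal.ofReal_rpow_of_nonneg (norm_nonneg _) (by positivity), ← ENNReal.ofReal_coe_nnreal,
      ← ENNReal.ofReal_mul NNReal.zero_le_coe, Real.coe_toNNReal _ hK]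
    refine ENNReal.ofReal_le_ofReal ?_
    simpa using hf x hx y hy
  refine ⟨?_, K.toNNReal, fun x hx y hy => ?_⟩
  · rw [show (1 : WithTop ℕ∞) = 0 + 1 by norm_num, contDiffOn_succ_iff_fderiv_of_isOpen hs]
    exact ⟨fun x hx => (hd x hx).differentiableWithinAt, by simp,
      contDiffOn_zero.2 (hH.continuousOn (by simp))⟩
  · simp only [fderivWithin_of_isOpen hs hx, fderivWithin_of_isOpen hs hy]
    exact hH x hx y hy

/-- Uniform estimates near a fixed point at which the derivative is the identity. -/
theorem HolderDiffAt.exists_ball_near_id {E : Type*} [NormedAddCommGroup E] [NormedSpace ℝ E]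
    {α : ℝ} (hα : 0 < α) {f : E → E} {p : E} (h : HolderDiffAt α f p) (hfp : f p = p)
    (hD : HasFDerivAt f (ContinuousLinearMap.id ℝ E) p) {ε : ℝ} (hε : 0 < ε) :
    ∃ r > 0, ∃ K > 0, (∀ x ∈ Metric.ball p r, DifferentiableAt ℝ f x) ∧
      (∀ x ∈ Metric.ball p r, ∀ y ∈ Metric.ball p r,
        ‖fderiv ℝ f x - fderiv ℝ f y‖ ≤ K * ‖x - y‖ ^ α) ∧
      ∀ x ∈ Metric.ball p r, ‖f x - x‖ ≤ ε ∧ ‖fderiv ℝ f x - ContinuousLinearMap.id ℝ E‖ ≤ ε := by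
  obtain ⟨r₁, hr₁, K, hK, h1, h2⟩ := h.exists_ball
  have h3 : ∀ᶠ x in 𝓝 p, ‖f x - x‖ < ε := by
    have hc : ContinuousAt (fun x => ‖f x - x‖) p := (hD.continuousAt.sub continuousAt_id).norm
    exact hc.eventually_lt continuousAt_const (by simpa [hfp] using hε)
  have h4 : ∀ᶠ x in 𝓝 p, ‖fderiv ℝ f x - ContinuousLinearMap.id ℝ E‖ < ε := by
    have hc : ContinuousAt (fun x => ‖fderiv ℝ f x - ContinuousLinearMap.id ℝ E‖) p :=
      ((h.continuousAt_fderiv hα).sub continuousAt_const).norm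
    exact hc.eventually_lt continuousAt_const (by simpa [hD.fderiv] using hε)
  obtain ⟨r₂, hr₂, h5⟩ := Metric.eventually_nhds_iff_ball.1 (h3.and h4)
  have hs₁ : Metric.ball p (min r₁ r₂) ⊆ Metric.ball p r₁ :=
    Metric.ball_subset_ball (min_le_left _ _)
  have hs₂ : Metric.ball p (min r₁ r₂) ⊆ Metric.ball p r₂ :=
    Metric.ball_subset_ball (min_le_right _ _)
  exact ⟨min r₁ r₂, by positivity, K, hK, fun x hx => h1 x (hs₁ hx),
    fun x hx y hy => h2 x (hs₁ hx) y (hs₁ hy),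
    fun x hx => ⟨(h5 x (hs₂ hx)).1.le, (h5 x (hs₂ hx)).2.le⟩⟩

/-- The deviation from the identity of a map whose derivative is the identity at `p` and
`1/2`-Hölder on a ball around `p`. -/
theorem norm_sub_sub_sub_le_of_holder {E : Type*} [NormedAddCommGroup E] [NormedSpace ℝ E]
    {f : E → E} {p : E} {r K : ℝ} (hr : 0 < r) (hK : 0 ≤ K)
    (hd : ∀ x ∈ Metric.ball p r, DifferentiableAt ℝ f x)
    (hf : ∀ x ∈ Metric.ball p r, ∀ y ∈ Metric.ball p r,
      ‖fderiv ℝ f x - fderiv ℝ f y‖ ≤ K * ‖x - y‖ ^ (1 / 2 : ℝ))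
    (hD : HasFDerivAt f (ContinuousLinearMap.id ℝ E) p) {x y : E}
    (hx : x ∈ Metric.ball p r) (hy : y ∈ Metric.ball p r) :
    ‖f x - f y - (x - y)‖ ≤ K * max (√‖x - p‖) (√‖y - p‖) * ‖x - y‖ := by
  set ρ := max ‖x - p‖ ‖y - p‖ with hρ
  have hρr : ρ < r := max_lt (by simpa [dist_eq_norm] using hx) (by simpa [dist_eq_norm] using hy)
  have hsub : Metric.closedBall p ρ ⊆ Metric.ball p r := Metric.closedBall_subset_ball hρr
  have hmax : max (√‖x - p‖) (√‖y - p‖) = √ρ :=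
    (Monotone.map_max (f := Real.sqrt) fun _ _ h => Real.sqrt_le_sqrt h).symm
  rw [hmax]
  have key := (convex_closedBall p ρ).norm_image_sub_le_of_norm_hasFDerivWithin_le
    (f := fun z => f z - z) (f' := fun z => fderiv ℝ f z - ContinuousLinearMap.id ℝ E)
    (C := K * √ρ) (x := y) (y := x)
    (fun z hz => ((hd z (hsub hz)).hasFDerivAt.sub (hasFDerivAt_id z)).hasFDerivWithinAt)
    (fun z hz => by
      have h1 := hf z (hsub hz) p (Metric.mem_ball_self hr)
      rw [hD.fderiv, ← Real.sqrt_eq_rpow] at h1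
      refine h1.trans (mul_le_mul_of_nonneg_left (Real.sqrt_le_sqrt ?_) hK)
      simpa [dist_eq_norm] using hz)
    (by simp [dist_eq_norm, hρ]) (by simp [dist_eq_norm, hρ])
  rwa [sub_sub_sub_comm] at key

/-- Lemma 6.2, `C^{1,1/2}` normal form at a hyperbolic fixed point:
an area-preserving `C²` diffeomorphism `g` near a fixed point `P` with
eigenvalues `λ, λ⁻¹`, `0 < λ < 1`, admits for every `ε > 0` a local `C^{1,1/2}`
linearization `Φ : V → U` that is `ε`-close to the identity in `C¹` and satisfies
`|Φ(w) − Φ(w') − (w − w')| ≤ M·max(|w−P|^{1/2}, |w'−P|^{1/2})·|w−w'|`. -/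
theorem stmt_8 (P : ℝ × ℝ) (W : Set (ℝ × ℝ)) (hWopen : IsOpen W) (hPW : P ∈ W)
    (g : ℝ × ℝ → ℝ × ℝ) (hg : ContDiffOn ℝ 2 g W) (hinj : Set.InjOn g W)
    (hgP : g P = P)
    (harea : ∀ w ∈ W, LinearMap.det ((fderiv ℝ g w) : ℝ × ℝ →ₗ[ℝ] ℝ × ℝ) = 1)
    (lam : ℝ) (hlam0 : 0 < lam) (hlam1 : lam < 1)
    (heig : Module.End.HasEigenvalue ((fderiv ℝ g P) : ℝ × ℝ →ₗ[ℝ] ℝ × ℝ) lam)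
    (heig' : Module.End.HasEigenvalue ((fderiv ℝ g P) : ℝ × ℝ →ₗ[ℝ] ℝ × ℝ) lam⁻¹) :
    ∀ ε > (0 : ℝ), ∃ (U V : Set (ℝ × ℝ)) (Φ Ψ : ℝ × ℝ → ℝ × ℝ),
      IsOpen U ∧ IsOpen V ∧ P ∈ U ∧ P ∈ V ∧
      Set.BijOn Φ V U ∧ (∀ w ∈ V, Ψ (Φ w) = w) ∧ (∀ w ∈ U, Φ (Ψ w) = w) ∧
      Φ P = P ∧ C1Half Φ V ∧ C1Half Ψ U ∧
      (∃ W' ∈ nhds P, W' ⊆ V ∧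
        ∀ w ∈ W', Ψ (g (Φ w)) = P + fderiv ℝ g P (w - P)) ∧
      (∀ w ∈ V, ‖Φ w - w‖ ≤ ε ∧
        ‖fderivWithin ℝ Φ V w - ContinuousLinearMap.id ℝ (ℝ × ℝ)‖ ≤ ε) ∧
      (∀ w ∈ U, ‖Ψ w - w‖ ≤ ε ∧
        ‖fderivWithin ℝ Ψ U w - ContinuousLinearMap.id ℝ (ℝ × ℝ)‖ ≤ ε) ∧
      ∃ M : ℝ, 0 ≤ M ∧ ∀ w ∈ V, ∀ w' ∈ V,
        ‖Φ w - Φ w' - (w - w')‖ ≤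
          M * max (Real.sqrt ‖w - P‖) (Real.sqrt ‖w' - P‖) * ‖w - w'‖ := by
  intro ε hε
  have hgH : HolderDiffAt 1 g P :=
    HolderDiffAt.of_contDiffAt (hg.contDiffAt (hWopen.mem_nhds hPW))
  obtain ⟨Θ, hΘ, hΘP, hΘD, hΘg⟩ := exists_linearization hgH hgP hlam0 hlam1 heig heig'
  have hhalf : (0 : ℝ) < 1 / 2 := by norm_num
  obtain ⟨e, he, heP, heH, heD⟩ := hΘ.exists_localInverse hhalf
    (A := ContinuousLinearEquiv.refl ℝ (ℝ × ℝ)) hΘD.fderiv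
  rw [hΘP] at heH heD
  have heD : HasFDerivAt e.symm (ContinuousLinearMap.id ℝ (ℝ × ℝ)) P := heD
  have hPt : P ∈ e.target := by
    have := e.map_source heP
    rwa [he, hΘP] at this
  have hsymP : e.symm P = P := by
    have := e.left_inv heP
    rwa [he, hΘP] at this
  have hcont : Tendsto e.symm (𝓝 P) (𝓝 P) := by
    simpa [ContinuousAt, hsymP] using heD.continuousAt
  have hinv : ∀ w ∈ e.target, Θ (e.symm w) = w := fun w hw => by
    have := e.right_inv hw
    rwa [he] at this
  obtain ⟨r₁, hr₁, K₁, hK₁, hd₁, hh₁, hb₁⟩ := hΘ.exists_ball_near_id hhalf hΘP hΘD hε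
  obtain ⟨r₂, hr₂, K₂, hK₂, hd₂, hh₂, hb₂⟩ := heH.exists_ball_near_id hhalf hsymP heD hε
  have hev : ∀ᶠ w in 𝓝 P, w ∈ e.target ∧ e.symm w ∈ Metric.ball P r₁ :=
    (e.open_target.eventually_mem hPt).and (hcont.eventually (Metric.ball_mem_nhds P hr₁))
  obtain ⟨r₃, hr₃, h₃⟩ := Metric.eventually_nhds_iff_ball.1 hev
  obtain ⟨r, hr, hrr₂, hrr₃⟩ : ∃ r > 0, r ≤ r₂ ∧ r ≤ r₃ :=
    ⟨min r₂ r₃, by positivity, min_le_left _ _, min_le_right _ _⟩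
  set V := Metric.ball P r with hV
  have hV₂ : V ⊆ Metric.ball P r₂ := Metric.ball_subset_ball hrr₂
  have hVt : V ⊆ e.target := fun w hw => (h₃ w (Metric.ball_subset_ball hrr₃ hw)).1
  have hPV : P ∈ V := Metric.mem_ball_self hr
  set U := e.symm '' V with hU
  have hUo : IsOpen U := e.isOpen_image_symm_of_subset_target Metric.isOpen_ball hVt
  have hU₁ : U ⊆ Metric.ball P r₁ := by
    rintro _ ⟨w, hw, rfl⟩
    exact (h₃ w (Metric.ball_subset_ball hrr₃ hw)).2
  refine ⟨U, V, e.symm, Θ, hUo, Metric.isOpen_ball, ⟨P, hPV, hsymP⟩, hPV,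
    (e.symm.injOn.mono hVt).bijOn_image, fun w hw => hinv w (hVt hw), ?_, hsymP,
    c1Half_of_holder Metric.isOpen_ball hK₂.le (fun w hw => hd₂ w (hV₂ hw))
      (fun w hw w' hw' => hh₂ w (hV₂ hw) w' (hV₂ hw')),
    c1Half_of_holder hUo hK₁.le (fun w hw => hd₁ w (hU₁ hw))
      (fun w hw w' hw' => hh₁ w (hU₁ hw) w' (hU₁ hw')), ?_, fun w hw => ?_, fun w hw => ?_,
    K₂, hK₂.le, fun w hw w' hw' => ?_⟩
  · rintro _ ⟨w, hw, rfl⟩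
    rw [hinv w (hVt hw)]
  · have hc : ∀ᶠ w in 𝓝 P, Θ (g (e.symm w)) = P + fderiv ℝ g P (Θ (e.symm w) - P) :=
      hcont.eventually hΘg
    refine ⟨V ∩ {w | Θ (g (e.symm w)) = P + fderiv ℝ g P (Θ (e.symm w) - P)},
      inter_mem (Metric.ball_mem_nhds P hr) hc, Set.inter_subset_left, fun w hw => ?_⟩
    have h := hw.2
    rwa [Set.mem_ofPred_eq, hinv w (hVt hw.1)] at h
  · rw [fderivWithin_of_isOpen Metric.isOpen_ball hw]
    exact hb₂ w (hV₂ hw)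
  · rw [fderivWithin_of_isOpen hUo hw]
    exact hb₁ w (hU₁ hw)
  · exact norm_sub_sub_sub_le_of_holder hr hK₂.le (fun w hw => hd₂ w (hV₂ hw))
      (fun w hw w' hw' => hh₂ w (hV₂ hw) w' (hV₂ hw')) heD hw hw'
end
end

section
/- (Discrete first variation with boundary terms, as used in estimate (I₀) of Theorem 6.1.) Let h : ℝ² → ℝ be C² with ‖D²h(u)‖ ≤ H for all u in a convex open set O ⊆ ℝ². Let m < M be integers and let y, z : {m, …, M} → ℝ be such that for every i with m ≤ i < M the segment joining (y_i, y_{i+1}) and (z_i, z_{i+1}) lies in O, and suppose y is stationary in the interior: ∂₂h(y_{i−1}, y_i) + ∂₁h(y_i, y_{i+1}) = 0 for all m < i < M. Then | Σ_{i=m}^{M−1} ( h(z_i, z_{i+1}) − h(y_i, y_{i+1}) ) − ∂₁h(y_m, y_{m+1})·(z_m − y_m) − ∂₂h(y_{M−1}, y_M)·(z_M − y_M) | ≤ 2H · Σ_{i=m}^{M} |z_i − y_i|². -/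
noncomputable section

/-- Adding the right endpoint to a sum over a half-open interval of integers. -/
lemma Int.sum_Ico_add_one_right {m M : ℤ} (hmM : m ≤ M) (f : ℤ → ℝ) :
    ∑ i ∈ Finset.Ico m (M + 1), f i = (∑ i ∈ Finset.Ico m M, f i) + f M := by
  have hset : Finset.Ico m (M + 1) = insert M (Finset.Ico m M) := by
    ext i
    simp only [Finset.mem_Ico, Finset.mem_insert]
    omega
  rw [hset, Finset.sum_insert (by simp), add_comm]

/-- Summation by parts: if the interior coefficients cancel, only the boundary terms remain. -/
lemma Int.sum_Ico_telescope_boundary {m M : ℤ} (hmM : m + 1 ≤ M) (A B d : ℤ → ℝ)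
    (hAB : ∀ i, m < i → i < M → B (i - 1) + A i = 0) :
    ∑ i ∈ Finset.Ico m M, (A i * d i + B i * d (i + 1)) = A m * d m + B (M - 1) * d M := by
  induction M, hmM using Int.leInduction with
  | base => simp [Int.sum_Ico_add_one_right le_rfl]
  | succ M hM ih =>
    rw [Int.sum_Ico_add_one_right (by omega), ih fun i h₁ h₂ => hAB i h₁ (by omega),
      add_sub_cancel_right]
    linear_combination d M * hAB M (by omega) (by omega)

/-- A sum over consecutive pairs counts each term twice, except for the two endpoints. -/
lemma Int.sum_Ico_add_succ {m M : ℤ} (hmM : m ≤ M) (e : ℤ → ℝ) :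
    ∑ i ∈ Finset.Ico m M, (e i + e (i + 1)) =
      2 * (∑ i ∈ Finset.Icc m M, e i) - e m - e M := by
  have hIcc : Finset.Icc m M = Finset.Ico m (M + 1) := by
    ext i
    simp only [Finset.mem_Icc, Finset.mem_Ico]
    omega
  rw [hIcc]
  clear hIcc
  induction M, hmM using Int.leInduction with
  | base =>
    simp only [Int.sum_Ico_add_one_right le_rfl, Finset.Ico_self, Finset.sum_empty]
    ring
  | succ M hM ih =>
    rw [Int.sum_Ico_add_one_right hM, Int.sum_Ico_add_one_right (by omega : m ≤ M + 1), ih]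
    ring

/-- First-order Taylor estimate along a segment on which the second derivative is bounded. -/
lemma norm_sub_sub_fderiv_le_of_norm_iteratedFDeriv_two_le
    {E F : Type*} [NormedAddCommGroup E] [NormedSpace ℝ E]
    [NormedAddCommGroup F] [NormedSpace ℝ F] {f : E → F} (hf : ContDiff ℝ 2 f)
    {C : ℝ} {v w : E} (hC : ∀ u ∈ segment ℝ v w, ‖iteratedFDeriv ℝ 2 f u‖ ≤ C) :
    ‖f w - f v - fderiv ℝ f v (w - v)‖ ≤ C * ‖w - v‖ ^ 2 := by
  have hC0 : 0 ≤ C := (norm_nonneg _).trans (hC v (left_mem_segment ℝ v w))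
  have hf' : Differentiable ℝ (fderiv ℝ f) :=
    (hf.fderiv_right (m := 1) (by norm_num)).differentiable (by norm_num)
  have hbound : ∀ u ∈ segment ℝ v w, ‖fderiv ℝ f u - fderiv ℝ f v‖ ≤ C * ‖w - v‖ := by
    intro u hu
    have hLip : ‖fderiv ℝ f u - fderiv ℝ f v‖ ≤ C * ‖u - v‖ := by
      refine (convex_segment v w).norm_image_sub_le_of_norm_fderiv_le (𝕜 := ℝ)
        (fun x _ => hf' x) (fun x hx => ?_) (left_mem_segment ℝ v w) hu
      rw [← norm_iteratedFDeriv_one, norm_iteratedFDeriv_fderiv]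
      exact hC x hx
    refine hLip.trans (mul_le_mul_of_nonneg_left ?_ hC0)
    obtain ⟨t, ⟨ht0, ht1⟩, rfl⟩ := (segment_eq_image' ℝ v w ▸ hu :
      u ∈ (fun t : ℝ => v + t • (w - v)) '' Set.Icc 0 1)
    simp only [add_sub_cancel_left, norm_smul, Real.norm_eq_abs, abs_of_nonneg ht0]
    exact mul_le_of_le_one_left (norm_nonneg _) ht1
  have hmv := (convex_segment v w).norm_image_sub_le_of_norm_fderiv_le' (𝕜 := ℝ)
    (fun x _ => hf.differentiable (by norm_num) x) hbound
    (left_mem_segment ℝ v w) (right_mem_segment ℝ v w)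
  calc _ ≤ C * ‖w - v‖ * ‖w - v‖ := hmv
    _ = _ := by ring

/-- The derivative of a function of two real variables in terms of its partial derivatives. -/
lemma fderiv_apply_eq_d1h_add_d2h {h : ℝ → ℝ → ℝ} {a b : ℝ}
    (hd : DifferentiableAt ℝ (fun u : ℝ × ℝ => h u.1 u.2) (a, b)) (s t : ℝ) :
    fderiv ℝ (fun u : ℝ × ℝ => h u.1 u.2) (a, b) (s, t) = d1h h a b * s + d2h h a b * t := by
  have h₁ : HasDerivAt (fun x => h x b)
      (fderiv ℝ (fun u : ℝ × ℝ => h u.1 u.2) (a, b) (1, 0)) a :=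
    hd.hasFDerivAt.comp_hasDerivAt (f := fun x : ℝ => (x, b)) a
      ((hasDerivAt_id a).prodMk (hasDerivAt_const a b))
  have h₂ : HasDerivAt (fun x => h a x)
      (fderiv ℝ (fun u : ℝ × ℝ => h u.1 u.2) (a, b) (0, 1)) b :=
    hd.hasFDerivAt.comp_hasDerivAt (f := fun x : ℝ => (a, x)) b
      ((hasDerivAt_const b a).prodMk (hasDerivAt_id b))
  have hst : ((s, t) : ℝ × ℝ) = s • (1, 0) + t • (0, 1) := by simp
  rw [d1h, d2h, h₁.deriv, h₂.deriv, hst, map_add, map_smul, map_smul]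
  simp only [smul_eq_mul]
  ring

/-- discrete first variation with boundary terms: if `h` is `C²`
with Hessian bounded by `H` on a convex open set `O`, the segments joining
`(y_i, y_{i+1})` to `(z_i, z_{i+1})` lie in `O`, and `y` is stationary in the
interior (`∂₂h(y_{i−1}, y_i) + ∂₁h(y_i, y_{i+1}) = 0` for `m < i < M`), then the
action difference equals the two boundary terms up to an error bounded by
`2H·∑ |z_i − y_i|²`. -/
theorem stmt_10 (h : ℝ → ℝ → ℝ)
    (hC2 : ContDiff ℝ 2 (fun u : ℝ × ℝ => h u.1 u.2))
    (O : Set (ℝ × ℝ)) (hOconv : Convex ℝ O) (hOopen : IsOpen O)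
    (H : ℝ)
    (hHess : ∀ u ∈ O, ‖iteratedFDeriv ℝ 2 (fun v : ℝ × ℝ => h v.1 v.2) u‖ ≤ H)
    (m M : ℤ) (hmM : m < M) (y z : ℤ → ℝ)
    (hseg : ∀ i : ℤ, m ≤ i → i < M →
      segment ℝ ((y i, y (i + 1)) : ℝ × ℝ) ((z i, z (i + 1)) : ℝ × ℝ) ⊆ O)
    (hstat : ∀ i : ℤ, m < i → i < M →
      d2h h (y (i - 1)) (y i) + d1h h (y i) (y (i + 1)) = 0) :
    |(∑ i ∈ Finset.Ico m M, (h (z i) (z (i + 1)) - h (y i) (y (i + 1))))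
        - d1h h (y m) (y (m + 1)) * (z m - y m)
        - d2h h (y (M - 1)) (y M) * (z M - y M)| ≤
      2 * H * ∑ i ∈ Finset.Icc m M, |z i - y i| ^ 2 := by
  have hH : 0 ≤ H := (norm_nonneg _).trans
    (hHess _ (hseg m le_rfl hmM (left_mem_segment ℝ _ _)))
  have hstep : ∀ i ∈ Finset.Ico m M,
      |h (z i) (z (i + 1)) - h (y i) (y (i + 1)) -
          (d1h h (y i) (y (i + 1)) * (z i - y i) +
            d2h h (y i) (y (i + 1)) * (z (i + 1) - y (i + 1)))| ≤
        H * (|z i - y i| ^ 2 + |z (i + 1) - y (i + 1)| ^ 2) := by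
    intro i hi
    obtain ⟨hmi, hiM⟩ := Finset.mem_Ico.mp hi
    have hT := norm_sub_sub_fderiv_le_of_norm_iteratedFDeriv_two_le hC2
      fun u hu => hHess u (hseg i hmi hiM hu)
    rw [Prod.mk_sub_mk, fderiv_apply_eq_d1h_add_d2h (hC2.differentiable (by norm_num) _),
      Real.norm_eq_abs] at hT
    refine hT.trans (mul_le_mul_of_nonneg_left ?_ hH)
    rw [Prod.norm_mk, Real.norm_eq_abs, Real.norm_eq_abs]
    rcases max_choice |z i - y i| |z (i + 1) - y (i + 1)| with hmax | hmax <;> rw [hmax]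
    · exact le_add_of_nonneg_right (sq_nonneg _)
    · exact le_add_of_nonneg_left (sq_nonneg _)
  have hlin := Int.sum_Ico_telescope_boundary hmM
    (fun i => d1h h (y i) (y (i + 1))) (fun i => d2h h (y i) (y (i + 1)))
    (fun i => z i - y i) (fun i h₁ h₂ => by simpa using hstat i h₁ h₂)
  have hsq := Int.sum_Ico_add_succ hmM.le fun i => |z i - y i| ^ 2
  simp only [sub_add_cancel] at hlin
  rw [sub_sub, ← hlin, ← Finset.sum_sub_distrib]
  calc _ ≤ ∑ i ∈ Finset.Ico m M, H * (|z i - y i| ^ 2 + |z (i + 1) - y (i + 1)| ^ 2) :=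
        (Finset.abs_sum_le_sum_abs _ _).trans (Finset.sum_le_sum hstep)
    _ = H * (2 * (∑ i ∈ Finset.Icc m M, |z i - y i| ^ 2)
          - |z m - y m| ^ 2 - |z M - y M| ^ 2) := by rw [← Finset.mul_sum, hsq]
    _ ≤ H * (2 * ∑ i ∈ Finset.Icc m M, |z i - y i| ^ 2) := by
        gcongr
        linarith [sq_nonneg |z m - y m|, sq_nonneg |z M - y M|]
    _ = _ := by ring
end
end
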